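/- arXiv:1904.12851 — 3 statements merged into one kernel-verified Lean document; each statement's English description precedes it below -/
import Mathlib

section
/- Let n = 2r+1 with r ≥ d. Then for every m ≥ 1, the ℋ^B_{Q,q}(d)-module V_m^{⊗d} is a direct summand of a finite direct sum of copies of V_n^{⊗d}: there exist an integer N ≥ 1 and k-linear maps ι : V_m^{⊗d} → (V_n^{⊗d})^{⊕N} and π : (V_n^{⊗d})^{⊕N} → V_m^{⊗d}, each intertwining the operators T_0, …, T_{d−1} (acting diagonally on the direct sum), such that π ∘ ι = Id. -/
noncomputable section
namespace QSP

variable {k : Type*} [Field k]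

/-- Doubled value of a basis index: `val n j = 2*j - (n-1)`, so that the basis
indices of `V_n` are the integers/half-integers `val/2` in `𝕀_n`. -/
def val (n : ℕ) (j : Fin n) : ℤ := 2 * (j : ℤ) - ((n : ℤ) - 1)

/-- Matrix of the operator `K_Q` on `V_n` in the standard basis. -/
def KQmat (Q : k) (n : ℕ) : Matrix (Fin n) (Fin n) k := fun c b =>
  if val n b = 0 then (if c = b then Q⁻¹ else 0)
  else (if c = Fin.rev b then 1 else 0) + (if val n b < 0 ∧ c = b then Q⁻¹ - Q else 0)

/-- Matrix of the operator `R_q` on `V_n ⊗ V_n` in the standard basis. -/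
def Rmat (q : k) (n : ℕ) : Matrix (Fin n × Fin n) (Fin n × Fin n) k := fun c b =>
  if b.1 = b.2 then (if c = b then q⁻¹ else 0)
  else if b.1 < b.2 then (if c = (b.2, b.1) then 1 else 0)
  else (if c = (b.2, b.1) then 1 else 0) + (if c = b then q⁻¹ - q else 0)

/-- The operators `T_i`, `0 ≤ i ≤ d-1`, on `V_n^{⊗ d}`; `T_0` acts as `K_Q` on the
first tensor factor, and `T_i` (for `i > 0`) acts as `R_q` on the `(i, i+1)`
tensor factors (1-based). -/
def TB (Q q : k) (n d : ℕ) (i : ℕ) : Module.End k ((Fin d → Fin n) → k) :=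
  if _h0 : i = 0 then
    if hd : 0 < d then
      Matrix.toLin' (fun c b =>
        if ∀ j, j ≠ (⟨0, hd⟩ : Fin d) → c j = b j then
          KQmat Q n (c ⟨0, hd⟩) (b ⟨0, hd⟩) else 0)
    else 0
  else if hi : i < d then
    Matrix.toLin' (fun c b =>
      if ∀ j, j ≠ (⟨i - 1, Nat.lt_of_le_of_lt (Nat.pred_le i) hi⟩ : Fin d) →
          j ≠ (⟨i, hi⟩ : Fin d) → c j = b j then
        Rmat q n (c ⟨i - 1, Nat.lt_of_le_of_lt (Nat.pred_le i) hi⟩, c ⟨i, hi⟩)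
          (b ⟨i - 1, Nat.lt_of_le_of_lt (Nat.pred_le i) hi⟩, b ⟨i, hi⟩) else 0)
  else 0

/-- The Jucys–Murphy elements `K_i = T_{i-1} ⋯ T_1 T_0 T_1 ⋯ T_{i-1}` acting on
`V_n^{⊗ d}`, for `1 ≤ i ≤ d` (junk value `1` for `i = 0`). -/
def JM (Q q : k) (n d : ℕ) : ℕ → Module.End k ((Fin d → Fin n) → k)
  | 0 => 1
  | 1 => TB Q q n d 0
  | i + 2 => TB Q q n d (i + 1) * JM Q q n d (i + 1) * TB Q q n d (i + 1)

/-- The element `c_K = K_1 K_2 ⋯ K_d` acting on `V_n^{⊗ d}`. -/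
def cK (Q q : k) (n d : ℕ) : Module.End k ((Fin d → Fin n) → k) :=
  ((List.range d).map (fun i => JM Q q n d (i + 1))).prod


def Sf {m d : ℕ} (f : Fin d → Fin m) : Finset (Fin m) :=
  Finset.univ.filter (fun c => ∃ j, c = f j ∨ c = Fin.rev (f j))

def Good {m n : ℕ} (S : Finset (Fin m)) (φ : Fin m → Fin n) : Prop :=
  (∀ c ∈ S, φ (Fin.rev c) = Fin.rev (φ c)) ∧ ∀ c ∈ S, ∀ c' ∈ S, c < c' → φ c < φ c'

lemma mem_Sf {m d : ℕ} (f : Fin d → Fin m) (j : Fin d) : f j ∈ Sf f := by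
  simp only [Sf, Finset.mem_filter, Finset.mem_univ, true_and]
  exact ⟨j, Or.inl rfl⟩

lemma rev_mem_Sf {m d : ℕ} (f : Fin d → Fin m) (c : Fin m) (h : c ∈ Sf f) :
    Fin.rev c ∈ Sf f := by
  simp only [Sf, Finset.mem_filter, Finset.mem_univ, true_and] at h ⊢
  obtain ⟨j, h | h⟩ := h
  · exact ⟨j, Or.inr (by rw [h])⟩
  · exact ⟨j, Or.inl (by rw [h, Fin.rev_rev])⟩

lemma Good.lt_iff {m n : ℕ} {S : Finset (Fin m)} {φ : Fin m → Fin n} (h : Good S φ)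
    {c c' : Fin m} (hc : c ∈ S) (hc' : c' ∈ S) : φ c < φ c' ↔ c < c' := by
  refine ⟨fun hl => ?_, h.2 c hc c' hc'⟩
  by_contra hn
  rcases eq_or_lt_of_le (not_lt.mp hn) with e | e
  · rw [e] at hl; exact lt_irrefl _ hl
  · exact lt_asymm hl (h.2 _ hc' _ hc e)

lemma Good.eq_iff {m n : ℕ} {S : Finset (Fin m)} {φ : Fin m → Fin n} (h : Good S φ)
    {c c' : Fin m} (hc : c ∈ S) (hc' : c' ∈ S) : φ c = φ c' ↔ c = c' := by
  refine ⟨fun hl => ?_, fun e => by rw [e]⟩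
  rcases lt_trichotomy c c' with e | e | e
  · exact absurd hl (h.2 _ hc _ hc' e).ne
  · exact e
  · exact absurd hl (h.2 _ hc' _ hc e).ne'

lemma exists_good {m d r : ℕ} (hr : d ≤ r) (f : Fin d → Fin m) :
    ∃ φ : Fin m → Fin (2 * r + 1), Good (Sf f) φ := by
  classical
  let P : Fin m → Finset (Fin m) := fun c => (Sf f).filter (fun s => Fin.rev s < s ∧ s ≤ c)
  let M : Fin m → Finset (Fin m) := fun c => (Sf f).filter (fun s => s < Fin.rev s ∧ c ≤ s)
  have hPM : ∀ c, (P (Fin.rev c)).card = (M c).card := by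
    intro c
    refine Finset.card_bij (fun s _ => Fin.rev s) ?_ ?_ ?_
    · intro s hs
      simp only [P, M, Finset.mem_filter, Fin.rev_rev] at hs ⊢
      exact ⟨rev_mem_Sf f s hs.1, hs.2.1, Fin.le_rev_iff.mp hs.2.2⟩
    · intro a _ b _ h
      exact Fin.rev_injective h
    · intro s hs
      simp only [P, M, Finset.mem_filter] at hs ⊢
      exact ⟨Fin.rev s, ⟨rev_mem_Sf f s hs.1, by rw [Fin.rev_rev]; exact hs.2.1,
        Fin.rev_le_rev.mpr hs.2.2⟩, Fin.rev_rev s⟩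
  have hPd : ∀ c, (P c).card ≤ d := by
    intro c
    have : P c ⊆ Finset.univ.image (fun j => max (f j) (Fin.rev (f j))) := by
      intro s hs
      simp only [P, Sf, Finset.mem_filter, Finset.mem_univ, true_and] at hs
      obtain ⟨⟨j, h | h⟩, h2, -⟩ := hs
      · refine Finset.mem_image.mpr ⟨j, Finset.mem_univ _, ?_⟩
        rw [h] at h2 ⊢
        exact max_eq_left h2.le
      · refine Finset.mem_image.mpr ⟨j, Finset.mem_univ _, ?_⟩
        rw [h, Fin.rev_rev] at h2
        rw [h]
        exact max_eq_right h2.le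
    calc _ ≤ _ := Finset.card_le_card this
      _ ≤ _ := Finset.card_image_le
      _ = d := by simp
  have hMd : ∀ c, (M c).card ≤ d := fun c => hPM c ▸ hPd _
  have hMP : ∀ c, (M (Fin.rev c)).card = (P c).card := by
    intro c; rw [← hPM, Fin.rev_rev]
  refine ⟨fun c => ⟨r + (P c).card - (M c).card, by have := hPd c; omega⟩, ?_, ?_⟩
  · intro c _
    apply Fin.ext
    simp only [Fin.val_rev, hPM, hMP]
    have := hPd c; have := hMd c
    omega
  · intro c hc c' hc' hlt
    rw [Fin.lt_def]
    show r + (P c).card - (M c).card < r + (P c').card - (M c').card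
    have h1 : P c ⊆ P c' := by
      intro s hs
      simp only [P, Finset.mem_filter] at hs ⊢
      exact ⟨hs.1, hs.2.1, hs.2.2.trans hlt.le⟩
    have h2 : M c' ⊆ M c := by
      intro s hs
      simp only [M, Finset.mem_filter] at hs ⊢
      exact ⟨hs.1, hs.2.1, hlt.le.trans hs.2.2⟩
    have h1c := Finset.card_le_card h1
    have h2c := Finset.card_le_card h2
    have b1 := hMd c
    have b2 := hMd c'
    by_cases hp : Fin.rev c' < c'
    · have : (P c).card < (P c').card := by
        apply Finset.card_lt_card
        refine Finset.ssubset_iff_subset_ne.mpr ⟨h1, fun e => ?_⟩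
        have : c' ∈ P c := by
          rw [e]; simp only [P, Finset.mem_filter]; exact ⟨hc', hp, le_rfl⟩
        simp only [P, Finset.mem_filter] at this
        exact absurd this.2.2 (not_le.mpr hlt)
      omega
    · have : (M c').card < (M c).card := by
        apply Finset.card_lt_card
        refine Finset.ssubset_iff_subset_ne.mpr ⟨h2, fun e => ?_⟩
        have : c ∈ M c' := by
          rw [e]; simp only [M, Finset.mem_filter]; refine ⟨hc, ?_, le_rfl⟩
          exact hlt.trans_le ((not_lt.mp hp).trans (Fin.rev_le_rev.mpr hlt.le))
        simp only [M, Finset.mem_filter] at this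
        exact absurd this.2.2 (not_le.mpr hlt)
      omega

/-- the underlying involution on words -/
def sw (n d i : ℕ) (hi : i < d) (c : Fin d → Fin n) : Fin d → Fin n :=
  if i = 0 then Function.update c ⟨i, hi⟩ (Fin.rev (c ⟨i, hi⟩))
  else c ∘ Equiv.swap (⟨i - 1, by omega⟩ : Fin d) ⟨i, hi⟩

def cA (Q q : k) (n d i : ℕ) (hi : i < d) (c : Fin d → Fin n) : k :=
  if i = 0 then (if c ⟨i, hi⟩ = Fin.rev (c ⟨i, hi⟩) then Q⁻¹ else
    if c ⟨i, hi⟩ < Fin.rev (c ⟨i, hi⟩) then Q⁻¹ - Q else 0)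
  else (if c ⟨i - 1, by omega⟩ = c ⟨i, hi⟩ then q⁻¹ else
    if c ⟨i, hi⟩ < c ⟨i - 1, by omega⟩ then q⁻¹ - q else 0)

def cB (n d i : ℕ) (hi : i < d) (c : Fin d → Fin n) : k :=
  if i = 0 then (if c ⟨i, hi⟩ = Fin.rev (c ⟨i, hi⟩) then 0 else 1)
  else (if c ⟨i - 1, by omega⟩ = c ⟨i, hi⟩ then 0 else 1)

lemma sw_sw (n d i : ℕ) (hi : i < d) (c : Fin d → Fin n) :
    sw n d i hi (sw n d i hi c) = c := by
  unfold sw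
  split_ifs
  · simp
  · funext j; simp

lemma Sf_sw_sub (n d i : ℕ) (hi : i < d) (c : Fin d → Fin n) :
    Sf (sw n d i hi c) ⊆ Sf c := by
  intro s hs
  have hs' := hs
  simp only [Sf, Finset.mem_filter, Finset.mem_univ, true_and] at hs'
  have key : ∀ j, sw n d i hi c j ∈ Sf c := by
    intro j
    unfold sw
    split_ifs
    · by_cases hj : j = ⟨i, hi⟩
      · subst hj
        rw [Function.update_self]; exact rev_mem_Sf _ _ (mem_Sf _ _)
      · rw [Function.update_of_ne hj]; exact mem_Sf _ _
    · exact mem_Sf _ _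
  obtain ⟨j, h | h⟩ := hs'
  · rw [h]; exact key j
  · rw [h]; exact rev_mem_Sf _ _ (key j)

lemma Sf_sw (n d i : ℕ) (hi : i < d) (c : Fin d → Fin n) :
    Sf (sw n d i hi c) = Sf c := by
  refine Finset.Subset.antisymm (Sf_sw_sub _ _ _ _ _) ?_
  conv_lhs => rw [← sw_sw n d i hi c]
  exact Sf_sw_sub _ _ _ _ _

lemma sw_comp {m n : ℕ} (d i : ℕ) (hi : i < d) (f : Fin d → Fin m) (φ : Fin m → Fin n)
    (h : Good (Sf f) φ) : sw n d i hi (φ ∘ f) = φ ∘ sw m d i hi f := by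
  unfold sw
  split_ifs
  · funext j
    by_cases hj : j = ⟨i, hi⟩
    · subst hj
      simp [h.1 _ (mem_Sf f _)]
    · simp [Function.update_of_ne hj]
  · rfl

lemma cA_comp (Q q : k) {m n : ℕ} (d i : ℕ) (hi : i < d) (f : Fin d → Fin m)
    (φ : Fin m → Fin n) (h : Good (Sf f) φ) :
    cA Q q n d i hi (φ ∘ f) = cA Q q m d i hi f := by
  have hm := mem_Sf f
  have hm' := fun j => rev_mem_Sf f _ (hm j)
  simp only [cA, Function.comp, ← h.1 _ (hm _), h.eq_iff (hm _) (hm _), h.lt_iff (hm _) (hm _),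
    h.eq_iff (hm _) (hm' _), h.lt_iff (hm _) (hm' _)]

lemma cB_comp {m n : ℕ} (d i : ℕ) (hi : i < d) (f : Fin d → Fin m)
    (φ : Fin m → Fin n) (h : Good (Sf f) φ) :
    (cB n d i hi (φ ∘ f) : k) = cB m d i hi f := by
  have hm := mem_Sf f
  have hm' := fun j => rev_mem_Sf f _ (hm j)
  simp only [cB, Function.comp, ← h.1 _ (hm _), h.eq_iff (hm _) (hm _), 
    h.eq_iff (hm _) (hm' _)]

lemma val_zero_iff (n : ℕ) (b : Fin n) : val n b = 0 ↔ b = Fin.rev b := by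
  rw [Fin.ext_iff, Fin.val_rev, val]; omega

lemma val_neg_iff (n : ℕ) (b : Fin n) : val n b < 0 ↔ b < Fin.rev b := by
  rw [Fin.lt_def, Fin.val_rev, val]; omega

lemma KQ_entry (Q : k) (n : ℕ) (v u : Fin n) : KQmat Q n v u =
    (if u = v then (if v = Fin.rev v then Q⁻¹ else if v < Fin.rev v then Q⁻¹ - Q else 0) else 0)
    + (if u = Fin.rev v then (if v = Fin.rev v then 0 else 1) else 0) := by
  unfold KQmat
  simp only [val_zero_iff, val_neg_iff]
  have E1 : v = Fin.rev u ↔ u = Fin.rev v := by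
    rw [Fin.ext_iff, Fin.ext_iff, Fin.val_rev, Fin.val_rev]; omega
  rw [if_congr E1 rfl rfl]
  by_cases huv : u = v
  · subst huv
    by_cases h1 : u = Fin.rev u
    · simp only [if_pos h1, if_true, add_zero]
    · simp only [if_neg h1, if_true, add_zero, zero_add, and_true]
  · have hvu : v ≠ u := fun h => huv h.symm
    simp only [if_neg huv, if_neg hvu, hvu, and_false, if_false, add_zero, zero_add]
    by_cases h : u = Fin.rev v
    · have h1 : u ≠ Fin.rev u := by
        intro h2; apply huv
        rw [h2, h, Fin.rev_rev]
      have h2 : v ≠ Fin.rev v := by rw [← h]; exact hvu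
      simp only [if_neg h1, if_neg h2, if_pos h]
    · simp [h]

lemma R_entry (q : k) (n : ℕ) (v v' u u' : Fin n) : Rmat q n (v, v') (u, u') =
    (if u = v ∧ u' = v' then (if v = v' then q⁻¹ else if v' < v then q⁻¹ - q else 0) else 0)
    + (if u = v' ∧ u' = v then (if v = v' then 0 else 1) else 0) := by
  simp only [Rmat, Prod.mk.injEq]
  rcases lt_trichotomy u u' with h | h | h
  · grind
  · grind
  · grind

lemma sum_two {X : Type*} [Fintype X] [DecidableEq X] (F x : X → k) (c s : X) (a b : k)
    (hF : ∀ y, F y = (if y = c then a else 0) + (if y = s then b else 0)) :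
    ∑ y, F y * x y = a * x c + b * x s := by
  simp [hF, add_mul, Finset.sum_add_distrib]

lemma TB_form (Q q : k) (n d i : ℕ) (hi : i < d) (x : (Fin d → Fin n) → k)
    (c : Fin d → Fin n) :
    TB Q q n d i x c = cA Q q n d i hi c * x c + cB n d i hi c * x (sw n d i hi c) := by
  by_cases h0 : i = 0
  · subst h0
    simp only [TB, cA, cB, sw, dif_pos hi, if_true, dite_true, Matrix.toLin'_apply, Matrix.mulVec,
      dotProduct]
    apply sum_two
    intro y
    have e1 : y = c ↔ (∀ j, j ≠ (⟨0, hi⟩ : Fin d) → c j = y j) ∧ y ⟨0, hi⟩ = c ⟨0, hi⟩ := by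
      constructor
      · rintro rfl; simp
      · rintro ⟨h1, h2⟩
        funext j
        by_cases hj : j = ⟨0, hi⟩
        · rw [hj, h2]
        · rw [h1 j hj]
    have e2 : y = Function.update c ⟨0, hi⟩ (Fin.rev (c ⟨0, hi⟩)) ↔
        (∀ j, j ≠ (⟨0, hi⟩ : Fin d) → c j = y j) ∧ y ⟨0, hi⟩ = Fin.rev (c ⟨0, hi⟩) := by
      rw [Function.eq_update_iff]
      constructor
      · rintro ⟨h1, h2⟩; exact ⟨fun j hj => (h2 j hj).symm, h1⟩
      · rintro ⟨h1, h2⟩; exact ⟨h2, fun j hj => (h1 j hj).symm⟩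
    show (if ∀ j, j ≠ (⟨0, hi⟩ : Fin d) → c j = y j then
          KQmat Q n (c ⟨0, hi⟩) (y ⟨0, hi⟩) else 0) = _
    rw [if_congr e1 rfl rfl, if_congr e2 rfl rfl]
    by_cases H : ∀ j, j ≠ (⟨0, hi⟩ : Fin d) → c j = y j
    · rw [if_pos H]
      have H' := eq_true H
      simp only [H', true_and]
      exact KQ_entry Q n _ _
    · rw [if_neg H]
      have H' := eq_false H
      simp only [H', false_and, if_false, add_zero]
  · have hlt : i - 1 < d := by omega
    have hne : (⟨i - 1, hlt⟩ : Fin d) ≠ ⟨i, hi⟩ := by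
      intro h; rw [Fin.mk.injEq] at h; omega
    simp only [TB, cA, cB, sw, dif_pos hi, h0, if_false, dite_false, Matrix.toLin'_apply,
      Matrix.mulVec, dotProduct]
    apply sum_two
    intro y
    generalize (⟨i - 1, hlt⟩ : Fin d) = p at hne ⊢
    generalize (⟨i, hi⟩ : Fin d) = p' at hne ⊢
    have e1 : y = c ↔ (∀ j, j ≠ p → j ≠ p' → c j = y j) ∧ (y p = c p ∧ y p' = c p') := by
      constructor
      · rintro rfl; simp
      · rintro ⟨h1, h2, h3⟩
        funext j
        by_cases hj : j = p
        · rw [hj, h2]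
        · by_cases hj' : j = p'
          · rw [hj', h3]
          · rw [h1 j hj hj']
    have e2 : y = c ∘ Equiv.swap p p' ↔
        (∀ j, j ≠ p → j ≠ p' → c j = y j) ∧ (y p = c p' ∧ y p' = c p) := by
      constructor
      · rintro rfl
        refine ⟨fun j h1 h2 => ?_, ?_, ?_⟩
        · simp [Equiv.swap_apply_of_ne_of_ne h1 h2]
        · simp
        · simp
      · rintro ⟨h1, h2, h3⟩
        funext j
        by_cases hj : j = p
        · rw [hj, h2]; simp
        · by_cases hj' : j = p'
          · rw [hj', h3]; simp
          · rw [← h1 j hj hj']; simp [Equiv.swap_apply_of_ne_of_ne hj hj']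
    show (if ∀ j, j ≠ p → j ≠ p' → c j = y j then
          Rmat q n (c p, c p') (y p, y p') else 0) = _
    rw [if_congr e1 rfl rfl, if_congr e2 rfl rfl]
    by_cases H : ∀ j, j ≠ p → j ≠ p' → c j = y j
    · rw [if_pos H]
      have H' := eq_true H
      simp only [H', true_and]
      exact R_entry q n _ _ _ _
    · rw [if_neg H]
      have H' := eq_false H
      simp only [H', false_and, if_false, add_zero]

open Classical in
def iotaS {m n d : ℕ} (φ : Fin m → Fin n) (S : Finset (Fin m)) :
    ((Fin d → Fin m) → k) →ₗ[k] ((Fin d → Fin n) → k) where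
  toFun x g := ∑ f, if Sf f = S ∧ φ ∘ f = g then x f else 0
  map_add' x y := by
    funext g
    simp only [Pi.add_apply, ← Finset.sum_add_distrib]
    refine Finset.sum_congr rfl fun f _ => ?_
    split_ifs <;> simp
  map_smul' a x := by
    funext g
    simp only [Pi.smul_apply, smul_eq_mul, Finset.mul_sum, RingHom.id_apply]
    refine Finset.sum_congr rfl fun f _ => ?_
    split_ifs <;> simp

lemma iotaS_of {m n d : ℕ} (φ : Fin m → Fin n) (f : Fin d → Fin m) (h : Good (Sf f) φ)
    (x : (Fin d → Fin m) → k) : iotaS φ (Sf f) x (φ ∘ f) = x f := by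
  show (∑ f', if Sf f' = Sf f ∧ φ ∘ f' = φ ∘ f then x f' else 0) = x f
  rw [Finset.sum_eq_single f]
  · simp
  · intro f' _ hne
    rw [if_neg]
    rintro ⟨h1, h2⟩
    apply hne
    funext j
    exact (h.eq_iff (h1 ▸ mem_Sf f' j) (mem_Sf f j)).mp (congrFun h2 j)
  · simp

lemma iotaS_not {m n d : ℕ} (φ : Fin m → Fin n) (S : Finset (Fin m)) (g : Fin d → Fin n)
    (h : ¬ ∃ f, Sf f = S ∧ φ ∘ f = g)
    (x : (Fin d → Fin m) → k) : iotaS φ S x g = 0 := by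
  show (∑ f', if Sf f' = S ∧ φ ∘ f' = g then x f' else 0) = 0
  refine Finset.sum_eq_zero fun f _ => ?_
  rw [if_neg]
  exact fun h' => h ⟨f, h'⟩

/-- For `n = 2r+1` with `r ≥ d`, and any `m ≥ 1`, the
`ℋ^B_{Q,q}(d)`-module `V_m^{⊗d}` is a direct summand of a finite direct sum of
copies of `V_n^{⊗d}`: there are intertwining linear maps `ι, π` with
`π ∘ ι = Id`. -/
theorem summand_of_odd_large
    (Q q : k) (hQ : Q ≠ 0) (hq : q ≠ 0) (d r : ℕ) (hd : 1 ≤ d) (hr : d ≤ r)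
    (m : ℕ) (hm : 1 ≤ m) :
    ∃ N : ℕ, 0 < N ∧
      ∃ (ι : ((Fin d → Fin m) → k) →ₗ[k] (Fin N → (Fin d → Fin (2 * r + 1)) → k))
        (π : (Fin N → (Fin d → Fin (2 * r + 1)) → k) →ₗ[k] ((Fin d → Fin m) → k)),
        (∀ i < d, ∀ x, ι (TB Q q m d i x) = fun t => TB Q q (2 * r + 1) d i (ι x t)) ∧
        (∀ i < d, ∀ y, π (fun t => TB Q q (2 * r + 1) d i (y t)) = TB Q q m d i (π y)) ∧
        π.comp ι = LinearMap.id := by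
  classical
  have hex : ∀ S : Finset (Fin m), ∃ φ : Fin m → Fin (2 * r + 1),
      ∀ f : Fin d → Fin m, Sf f = S → Good S φ := by
    intro S
    by_cases h : ∃ f : Fin d → Fin m, Sf f = S
    · obtain ⟨f, rfl⟩ := h
      obtain ⟨φ, hφ⟩ := exists_good hr f
      exact ⟨φ, fun _ _ => hφ⟩
    · exact ⟨fun _ => 0, fun f hf => absurd ⟨f, hf⟩ h⟩
  choose φ hφ' using hex
  have hφ : ∀ f : Fin d → Fin m, Good (Sf f) (φ (Sf f)) := fun f => hφ' _ f rfl
  let e := Fintype.equivFin (Finset (Fin m))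
  refine ⟨Fintype.card (Finset (Fin m)), Fintype.card_pos,
    LinearMap.pi (fun t => iotaS (φ (e.symm t)) (e.symm t)),
    LinearMap.pi (fun f => (LinearMap.proj (φ (Sf f) ∘ f) : ((Fin d → Fin (2 * r + 1)) → k) →ₗ[k] k).comp
      (LinearMap.proj (e (Sf f)) : (Fin _ → (Fin d → Fin (2 * r + 1)) → k) →ₗ[k] _)), ?_, ?_, ?_⟩
  · intro i hi x
    funext t g
    simp only [LinearMap.pi_apply]
    generalize e.symm t = S
    rw [TB_form Q q _ d i hi]
    by_cases h : ∃ f, Sf f = S ∧ φ S ∘ f = g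
    · obtain ⟨f, rfl, rfl⟩ := h
      have h2 := iotaS_of (φ (Sf f)) (sw m d i hi f)
        (by rw [Sf_sw]; exact hφ f) x
      rw [Sf_sw] at h2
      rw [iotaS_of _ _ (hφ f), iotaS_of _ _ (hφ f), TB_form Q q _ d i hi, cA_comp _ _ _ _ _ _ _ (hφ f),
        cB_comp _ _ _ _ _ (hφ f), sw_comp _ _ _ _ _ (hφ f), h2]
    · rw [iotaS_not _ _ _ h, iotaS_not _ _ _ h, iotaS_not]
      · simp
      · rintro ⟨f, rfl, h2⟩
        apply h
        refine ⟨sw m d i hi f, Sf_sw _ _ _ _ _, ?_⟩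
        rw [← sw_comp _ _ _ _ _ (hφ f), h2, sw_sw]
  · intro i hi y
    funext f
    rw [TB_form Q q _ d i hi]
    simp only [LinearMap.pi_apply, LinearMap.comp_apply, LinearMap.proj_apply]
    rw [TB_form Q q _ d i hi, cA_comp _ _ _ _ _ _ _ (hφ f),
        cB_comp _ _ _ _ _ (hφ f), sw_comp _ _ _ _ _ (hφ f), Sf_sw]
  · ext x f
    simp [iotaS_of _ _ (hφ _)]

end QSP
end
end

section
/- If m and n are odd integers with m, n ≥ 2d, then the type B Schur algebras S^B_{Q,q}(m; d) and S^B_{Q,q}(n; d) are Morita equivalent, i.e. their categories of modules are equivalent. -/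
universe u

noncomputable section
namespace QSP

variable {k : Type*} [Field k]

/-- The type B Schur algebra `S^B_{Q,q}(n; d)`: the subalgebra of
`End(V_n^{⊗d})` of all endomorphisms commuting with `T_0, …, T_{d-1}`. -/
def schurB (Q q : k) (n d : ℕ) : Subalgebra k (Module.End k ((Fin d → Fin n) → k)) :=
  Subalgebra.centralizer k (TB Q q n d '' Set.Iio d)


section intertwine

def al0 (Q : k) {n : ℕ} (c : Fin n) : k :=
  if Fin.rev c = c then Q⁻¹ else if c < Fin.rev c then Q⁻¹ - Q else 0

def be0 (k : Type*) [Field k] {n : ℕ} (c : Fin n) : k := if Fin.rev c = c then 0 else 1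

def al1 (q : k) {n : ℕ} (c d : Fin n) : k :=
  if c = d then q⁻¹ else if d < c then q⁻¹ - q else 0

def be1 (k : Type*) [Field k] {n : ℕ} (c d : Fin n) : k := if c = d then 0 else 1

theorem val_zero {n : ℕ} (c : Fin n) : val n c = 0 ↔ Fin.rev c = c := by
  rw [Fin.ext_iff, Fin.val_rev, val]; have := c.2; omega

theorem val_neg {n : ℕ} (c : Fin n) : val n c < 0 ↔ c < Fin.rev c := by
  rw [Fin.lt_def, Fin.val_rev, val]; have := c.2; omega

theorem KQ_eq (Q : k) {n : ℕ} (c b : Fin n) : KQmat Q n c b =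
    (if b = c then al0 Q c else 0) + (if b = Fin.rev c then be0 k c else 0) := by
  unfold KQmat al0 be0
  simp only [val_zero, val_neg]
  by_cases h1 : b = c
  · subst h1
    by_cases h2 : Fin.rev b = b
    · simp [h2]
    · simp [h2, Ne.symm h2]
  · by_cases h2 : b = Fin.rev c
    · subst h2
      have h3 : ¬ c = Fin.rev c := fun h => h1 h.symm
      simp [h1, h3]
    · have h3 : ¬ c = Fin.rev b := fun h => h2 (by rw [h, Fin.rev_rev])
      simp [h1, h2, h3, Ne.symm h1]

theorem Rm_eq (q : k) {n : ℕ} (c b : Fin n × Fin n) : Rmat q n c b =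
    (if b = c then al1 q c.1 c.2 else 0) + (if b = (c.2, c.1) then be1 k c.1 c.2 else 0) := by
  obtain ⟨c1, c2⟩ := c
  obtain ⟨b1, b2⟩ := b
  unfold Rmat al1 be1
  simp only [Prod.mk.injEq]
  split_ifs <;> grind

theorem TB_zero (Q q : k) (n d : ℕ) (hd : 0 < d) (x : (Fin d → Fin n) → k) (c : Fin d → Fin n) :
    TB Q q n d 0 x c = al0 Q (c ⟨0, hd⟩) * x c
      + be0 k (c ⟨0, hd⟩) * x (Function.update c ⟨0, hd⟩ (Fin.rev (c ⟨0, hd⟩))) := by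
  have hM : ∀ b : Fin d → Fin n, (if ∀ j, j ≠ (⟨0, hd⟩ : Fin d) → c j = b j then
          KQmat Q n (c ⟨0, hd⟩) (b ⟨0, hd⟩) else 0) =
      (if b = c then al0 Q (c ⟨0, hd⟩) else 0) +
      (if b = Function.update c ⟨0, hd⟩ (Fin.rev (c ⟨0, hd⟩)) then be0 k (c ⟨0, hd⟩) else 0) := by
    intro b
    have e1 : b = c ↔ (∀ j, j ≠ (⟨0, hd⟩ : Fin d) → c j = b j) ∧ b ⟨0, hd⟩ = c ⟨0, hd⟩ := by
      constructor
      · rintro rfl; simp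
      · rintro ⟨h1, h2⟩
        funext j
        by_cases hj : j = ⟨0, hd⟩
        · rw [hj, h2]
        · exact (h1 j hj).symm
    have e2 : b = Function.update c ⟨0, hd⟩ (Fin.rev (c ⟨0, hd⟩)) ↔
        (∀ j, j ≠ (⟨0, hd⟩ : Fin d) → c j = b j) ∧ b ⟨0, hd⟩ = Fin.rev (c ⟨0, hd⟩) := by
      rw [Function.eq_update_iff, and_comm]
      exact and_congr_left fun _ => forall_congr' fun j => imp_congr_right fun _ => eq_comm
    rw [KQ_eq]
    simp only [e1, e2]
    by_cases h : ∀ j, j ≠ (⟨0, hd⟩ : Fin d) → c j = b j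
    · rw [if_pos h]
      simp only [eq_true h, true_and]
    · simp only [h, false_and, if_false, add_zero]
  unfold TB
  rw [dif_pos rfl, dif_pos hd]
  change ∑ b : Fin d → Fin n, (if ∀ j, j ≠ (⟨0, hd⟩ : Fin d) → c j = b j then
          KQmat Q n (c ⟨0, hd⟩) (b ⟨0, hd⟩) else 0) * x b = _
  simp only [hM, add_mul, Finset.sum_add_distrib, ite_mul, zero_mul, Finset.sum_ite_eq',
    Finset.mem_univ, if_true]

theorem TB_succ (Q q : k) (n d i : ℕ) (hi : i + 1 < d) (x : (Fin d → Fin n) → k)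
    (c : Fin d → Fin n) :
    TB Q q n d (i + 1) x c = al1 q (c ⟨i, by omega⟩) (c ⟨i + 1, hi⟩) * x c
      + be1 k (c ⟨i, by omega⟩) (c ⟨i + 1, hi⟩) *
        x (c ∘ Equiv.swap ⟨i, by omega⟩ ⟨i + 1, hi⟩) := by
  have hlt : i < d := by omega
  have hne : (⟨i, hlt⟩ : Fin d) ≠ ⟨i + 1, hi⟩ := by simp
  generalize hp : (⟨i, hlt⟩ : Fin d) = p at *
  generalize hr : (⟨i + 1, hi⟩ : Fin d) = r at *
  have hM : ∀ b : Fin d → Fin n, (if ∀ j, j ≠ p → j ≠ r → c j = b j then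
          Rmat q n (c p, c r) (b p, b r) else 0) =
      (if b = c then al1 q (c p) (c r) else 0) +
      (if b = c ∘ Equiv.swap p r then be1 k (c p) (c r) else 0) := by
    intro b
    have e1 : b = c ↔ (∀ j, j ≠ p → j ≠ r → c j = b j) ∧ (b p, b r) = (c p, c r) := by
      constructor
      · rintro rfl; simp
      · rintro ⟨h1, h2⟩
        simp only [Prod.mk.injEq] at h2
        funext j
        by_cases hj : j = p
        · rw [hj, h2.1]
        by_cases hj' : j = r
        · rw [hj', h2.2]
        exact (h1 j hj hj').symm
    have e2 : b = c ∘ Equiv.swap p r ↔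
        (∀ j, j ≠ p → j ≠ r → c j = b j) ∧ (b p, b r) = (c r, c p) := by
      constructor
      · rintro rfl
        refine ⟨fun j h1 h2 => by simp [Equiv.swap_apply_of_ne_of_ne h1 h2], by simp⟩
      · rintro ⟨h1, h2⟩
        simp only [Prod.mk.injEq] at h2
        funext j
        by_cases hj : j = p
        · rw [hj, h2.1]; simp
        by_cases hj' : j = r
        · rw [hj', h2.2]; simp
        rw [← h1 j hj hj', Function.comp, Equiv.swap_apply_of_ne_of_ne hj hj']
    rw [Rm_eq]
    simp only [e1, e2]
    by_cases h : ∀ j, j ≠ p → j ≠ r → c j = b j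
    · rw [if_pos h]
      simp only [eq_true h, true_and]
    · simp only [h, false_and, if_false, add_zero]
  unfold TB
  rw [dif_neg (Nat.succ_ne_zero i), dif_pos hi]
  subst hp hr
  change ∑ b : Fin d → Fin n, (if ∀ j, j ≠ (⟨i, hlt⟩ : Fin d) → j ≠ (⟨i + 1, hi⟩ : Fin d) →
      c j = b j then Rmat q n (c ⟨i, hlt⟩, c ⟨i + 1, hi⟩) (b ⟨i, hlt⟩, b ⟨i + 1, hi⟩)
      else 0) * x b = _
  simp only [hM, add_mul, Finset.sum_add_distrib, ite_mul, zero_mul, Finset.sum_ite_eq',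
    Finset.mem_univ, if_true]

open Classical in
/-- pull back along `ψ`, cut off to `D`. -/
def pull (k : Type*) [Field k] {m n d : ℕ} (ψ : Fin m → Fin n) (D : Set (Fin d → Fin m)) :
    ((Fin d → Fin n) → k) →ₗ[k] ((Fin d → Fin m) → k) where
  toFun x g := if g ∈ D then x (ψ ∘ g) else 0
  map_add' x y := by funext g; by_cases h : g ∈ D <;> simp [h]
  map_smul' x y := by funext g; by_cases h : g ∈ D <;> simp [h]

theorem pull_pos {m n d : ℕ} (ψ : Fin m → Fin n) (D : Set (Fin d → Fin m))
    (x : (Fin d → Fin n) → k) {g : Fin d → Fin m} (h : g ∈ D) : pull k ψ D x g = x (ψ ∘ g) :=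
  if_pos h

theorem pull_neg {m n d : ℕ} (ψ : Fin m → Fin n) (D : Set (Fin d → Fin m))
    (x : (Fin d → Fin n) → k) {g : Fin d → Fin m} (h : g ∉ D) : pull k ψ D x g = 0 :=
  if_neg h

/-- intertwiners -/
def Tw (Q q : k) (m n d : ℕ) (B : ((Fin d → Fin n) → k) →ₗ[k] ((Fin d → Fin m) → k)) : Prop :=
  ∀ i < d, ∀ x, B (TB Q q n d i x) = TB Q q m d i (B x)

theorem pull_tw (Q q : k) {m n d : ℕ} (ψ : Fin m → Fin n) (D : Set (Fin d → Fin m))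
    (U : Set (Fin m)) (hDU : ∀ g ∈ D, ∀ j, g j ∈ U)
    (hmono : StrictMonoOn ψ U) (hrev : ∀ u ∈ U, ψ (Fin.rev u) = Fin.rev (ψ u))
    (hUrev : ∀ u ∈ U, Fin.rev u ∈ U)
    (hD0 : ∀ g ∈ D, ∀ j, Function.update g j (Fin.rev (g j)) ∈ D)
    (hD1 : ∀ g ∈ D, ∀ i j, g ∘ Equiv.swap i j ∈ D) : Tw Q q m n d (pull k ψ D) := by
  intro i hi x
  funext g
  cases i with
  | zero =>
    rw [TB_zero _ _ _ _ hi]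
    by_cases hg : g ∈ D
    · rw [pull_pos _ _ _ hg, pull_pos _ _ _ hg, pull_pos _ _ _ (hD0 g hg _), TB_zero _ _ _ _ hi]
      have hu := hDU g hg ⟨0, hi⟩
      have h1 : Fin.rev (ψ (g ⟨0, hi⟩)) = ψ (g ⟨0, hi⟩) ↔ Fin.rev (g ⟨0, hi⟩) = g ⟨0, hi⟩ := by
        rw [← hrev _ hu]
        exact hmono.injOn.eq_iff (hUrev _ hu) hu
      have h2 : ψ (g ⟨0, hi⟩) < Fin.rev (ψ (g ⟨0, hi⟩)) ↔ g ⟨0, hi⟩ < Fin.rev (g ⟨0, hi⟩) := by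
        rw [← hrev _ hu]
        exact hmono.lt_iff_lt hu (hUrev _ hu)
      have h3 : Function.update (ψ ∘ g) ⟨0, hi⟩ (Fin.rev ((ψ ∘ g) ⟨0, hi⟩)) =
          ψ ∘ Function.update g ⟨0, hi⟩ (Fin.rev (g ⟨0, hi⟩)) := by
        rw [Function.comp_update, hrev _ hu]; rfl
      rw [h3]
      simp only [al0, be0, Function.comp_apply, h1, h2]
    · have hg' : Function.update g ⟨0, hi⟩ (Fin.rev (g ⟨0, hi⟩)) ∉ D := fun h => hg (by
        have := hD0 _ h ⟨0, hi⟩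
        simpa using this)
      rw [pull_neg _ _ _ hg, pull_neg _ _ _ hg, pull_neg _ _ _ hg']
      simp
  | succ i =>
    rw [TB_succ _ _ _ _ _ hi]
    by_cases hg : g ∈ D
    · rw [pull_pos _ _ _ hg, pull_pos _ _ _ hg, pull_pos _ _ _ (hD1 g hg _ _),
        TB_succ _ _ _ _ _ hi]
      have h1 : ∀ a b, ψ (g a) = ψ (g b) ↔ g a = g b := fun a b =>
        hmono.injOn.eq_iff (hDU g hg _) (hDU g hg _)
      have h2 : ∀ a b, ψ (g a) < ψ (g b) ↔ g a < g b := fun a b =>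
        hmono.lt_iff_lt (hDU g hg _) (hDU g hg _)
      simp only [al1, be1, Function.comp_apply, h1, h2]
      rfl
    · have hg' : g ∘ Equiv.swap ⟨i, by omega⟩ ⟨i + 1, hi⟩ ∉ D := fun h => hg (by
        have := hD1 _ h ⟨i, by omega⟩ ⟨i + 1, hi⟩
        rw [Function.comp_assoc] at this
        simpa [← Equiv.coe_trans] using this)
      rw [pull_neg _ _ _ hg, pull_neg _ _ _ hg, pull_neg _ _ _ hg']
      simp

/-- the pull-back through a span `Fin m ← Fin s → Fin n`. -/
theorem span_tw (Q q : k) {m n d s : ℕ} (hn : 0 < n) (t : Fin s → Fin m) (e : Fin s → Fin n)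
    (ht : StrictMono t) (he : StrictMono e) (htr : ∀ i, t (Fin.rev i) = Fin.rev (t i))
    (her : ∀ i, e (Fin.rev i) = Fin.rev (e i)) :
    ∃ ψ : Fin m → Fin n, (∀ i, ψ (t i) = e i) ∧
      ∀ D : Set (Fin d → Fin m), (∀ g ∈ D, ∀ j, g j ∈ Set.range t) →
        (∀ g ∈ D, ∀ j, Function.update g j (Fin.rev (g j)) ∈ D) →
        (∀ g ∈ D, ∀ i j, g ∘ Equiv.swap i j ∈ D) → Tw Q q m n d (pull k ψ D) := by
  have hψ : ∀ i, Function.extend t e (fun _ => ⟨0, hn⟩) (t i) = e i :=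
    fun i => ht.injective.extend_apply e _ i
  refine ⟨Function.extend t e (fun _ => ⟨0, hn⟩), hψ, fun D hD h0 h1 => ?_⟩
  refine pull_tw Q q _ D (Set.range t) hD ?_ ?_ ?_ h0 h1
  · rintro _ ⟨a, rfl⟩ _ ⟨b, rfl⟩ hab
    rw [hψ, hψ]
    exact he (ht.lt_iff_lt.1 hab)
  · rintro _ ⟨a, rfl⟩
    rw [← htr, hψ, hψ, her]
  · rintro _ ⟨a, rfl⟩
    exact ⟨Fin.rev a, htr a⟩

theorem range_D {m d s : ℕ} (t : Fin s → Fin m) (htr : ∀ i, t (Fin.rev i) = Fin.rev (t i)) :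
    (∀ g ∈ {g : Fin d → Fin m | ∀ j, g j ∈ Set.range t}, ∀ j,
      Function.update g j (Fin.rev (g j)) ∈ {g : Fin d → Fin m | ∀ j, g j ∈ Set.range t}) ∧
    (∀ g ∈ {g : Fin d → Fin m | ∀ j, g j ∈ Set.range t}, ∀ i j,
      g ∘ Equiv.swap i j ∈ {g : Fin d → Fin m | ∀ j, g j ∈ Set.range t}) := by
  refine ⟨fun g hg j l => ?_, fun g hg i j l => hg _⟩
  by_cases h : l = j
  · subst h
    obtain ⟨a, ha⟩ := hg l
    rw [Function.update_self, ← ha, ← htr]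
    exact ⟨_, rfl⟩
  · rw [Function.update_of_ne h]
    exact hg l

/-- centred embedding -/
def cen {s m : ℕ} (h : s ≤ m) (i : Fin s) : Fin m := ⟨i + (m - s) / 2, by have := i.2; omega⟩

theorem cen_mono {s m : ℕ} (h : s ≤ m) : StrictMono (cen h) := by
  intro a b hab
  rw [Fin.lt_def] at *
  simp only [cen]; omega

theorem cen_rev {s m : ℕ} (h : s ≤ m) (hs : Odd s) (hm : Odd m) (i : Fin s) :
    cen h (Fin.rev i) = Fin.rev (cen h i) := by
  rw [Fin.ext_iff]
  simp only [cen, Fin.val_rev]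
  obtain ⟨a, rfl⟩ := hs
  obtain ⟨b, rfl⟩ := hm
  have := i.2
  omega

def ctr {n : ℕ} (hn : Odd n) : Fin n := ⟨n / 2, by obtain ⟨a, rfl⟩ := hn; omega⟩

theorem ctr_rev {n : ℕ} (hn : Odd n) : Fin.rev (ctr hn) = ctr hn := by
  rw [Fin.ext_iff]
  simp only [ctr, Fin.val_rev]
  obtain ⟨a, rfl⟩ := hn
  omega

/-- symmetrised support -/
def supp {n d : ℕ} (hn : Odd n) (f : Fin d → Fin n) : Finset (Fin n) :=
  insert (ctr hn) (Finset.univ.image f ∪ Finset.univ.image (fun j => Fin.rev (f j)))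

theorem mem_supp {n d : ℕ} (hn : Odd n) (f : Fin d → Fin n) (a : Fin n) :
    a ∈ supp hn f ↔ a = ctr hn ∨ ∃ j, f j = a ∨ Fin.rev (f j) = a := by
  simp [supp, exists_or]

theorem supp_rev {n d : ℕ} (hn : Odd n) (f : Fin d → Fin n) (a : Fin n) (h : a ∈ supp hn f) :
    Fin.rev a ∈ supp hn f := by
  rw [mem_supp] at *
  rcases h with rfl | ⟨j, rfl | rfl⟩
  · left; exact ctr_rev hn
  · right; exact ⟨j, Or.inr rfl⟩
  · right; exact ⟨j, Or.inl (Fin.rev_rev _).symm⟩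

theorem supp_card {n d : ℕ} (hn : Odd n) (f : Fin d → Fin n) : (supp hn f).card ≤ 2 * d + 1 := by
  unfold supp
  refine (Finset.card_insert_le _ _).trans ?_
  have h1 := Finset.card_union_le (Finset.univ.image f)
    (Finset.univ.image (fun j => Fin.rev (f j)))
  have h2 : (Finset.univ.image f).card ≤ d := Finset.card_image_le.trans (by simp)
  have h3 : (Finset.univ.image (fun j => Fin.rev (f j))).card ≤ d :=
    Finset.card_image_le.trans (by simp)
  omega

theorem supp_update {n d : ℕ} (hn : Odd n) (f : Fin d → Fin n) (j : Fin d) :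
    supp hn (Function.update f j (Fin.rev (f j))) = supp hn f := by
  ext a
  rw [mem_supp, mem_supp]
  refine or_congr_right (exists_congr fun l => ?_)
  by_cases h : l = j
  · subst h
    rw [Function.update_self, Fin.rev_rev, or_comm]
  · rw [Function.update_of_ne h]

theorem supp_swap {n d : ℕ} (hn : Odd n) (f : Fin d → Fin n) (i j : Fin d) :
    supp hn (f ∘ Equiv.swap i j) = supp hn f := by
  ext a
  rw [mem_supp, mem_supp]
  exact or_congr_right ((Equiv.swap i j).exists_congr_left.trans (by simp))

theorem sym_emb {n : ℕ} (hn : Odd n) (S : Finset (Fin n)) (hc : ctr hn ∈ S)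
    (hS : ∀ a ∈ S, Fin.rev a ∈ S) : ∃ e : Fin S.card → Fin n, StrictMono e ∧
      (∀ i, e (Fin.rev i) = Fin.rev (e i)) ∧ Set.range e = S ∧ Odd S.card := by
  let e := S.orderEmbOfFin rfl
  have hr : Set.range e = S := Finset.range_orderEmbOfFin S rfl
  have hm : ∀ i, e i ∈ S := fun i => Finset.orderEmbOfFin_mem S rfl i
  have h1 : (fun i => Fin.rev (e (Fin.rev i))) = e := by
    apply Finset.orderEmbOfFin_unique rfl
    · intro i; exact hS _ (hm _)
    · intro a b hab
      exact Fin.rev_lt_rev.2 (e.strictMono (Fin.rev_lt_rev.2 hab))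
  have h2 : ∀ i, e (Fin.rev i) = Fin.rev (e i) := fun i => by
    have := congrFun h1 (Fin.rev i)
    simp only [Fin.rev_rev] at this
    exact this.symm
  refine ⟨e, e.strictMono, h2, hr, ?_⟩
  have : ctr hn ∈ Set.range e := by rw [hr]; exact hc
  obtain ⟨i, hi⟩ := this
  have h3 : Fin.rev i = i := e.injective (by rw [h2, hi, ctr_rev])
  rw [Fin.ext_iff, Fin.val_rev] at h3
  have := i.2
  exact ⟨i, by omega⟩

theorem piece (Q q : k) {m n d : ℕ} (hm : 2 * d ≤ m) (hmo : Odd m) (hno : Odd n)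
    (S : Finset (Fin n)) :
    ∃ (A : ((Fin d → Fin m) → k) →ₗ[k] ((Fin d → Fin n) → k))
      (B : ((Fin d → Fin n) → k) →ₗ[k] ((Fin d → Fin m) → k)),
      Tw Q q n m d A ∧ Tw Q q m n d B ∧
      ∀ y f, A (B y) f = if supp hno f = S then y f else 0 := by
  by_cases hS : ∃ f : Fin d → Fin n, supp hno f = S
  · obtain ⟨f0, hf0⟩ := hS
    have hsm : S.card ≤ m := by
      have := supp_card hno f0
      rw [hf0] at this
      obtain ⟨a, rfl⟩ := hmo
      omega
    obtain ⟨e, he, her, hran, hodd⟩ := sym_emb hno S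
      (by rw [← hf0, mem_supp]; left; rfl) (by rw [← hf0]; exact supp_rev hno f0)
    have ht := cen_mono hsm
    have htr := cen_rev hsm hodd hmo
    obtain ⟨ψ, hψ, hB⟩ := span_tw (d := d) Q q hno.pos _ e ht he htr her
    obtain ⟨σ, hσ, hA⟩ := span_tw (d := d) Q q hmo.pos e _ he ht her htr
    have hDU : ∀ f ∈ {f : Fin d → Fin n | supp hno f = S}, ∀ j, f j ∈ Set.range e := by
      intro f hf j
      rw [hran]
      have hf' : supp hno f = S := hf
      rw [← hf']
      exact (mem_supp hno f _).2 (Or.inr ⟨j, Or.inl rfl⟩)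
    refine ⟨pull k σ {f | supp hno f = S}, pull k ψ {g | ∀ j, g j ∈ Set.range (cen hsm)},
      hA _ hDU ?_ ?_, hB _ (fun g hg => hg) (range_D _ htr).1 (range_D _ htr).2, ?_⟩
    · intro f hf j
      exact (supp_update hno f j).trans hf
    · intro f hf i j
      exact (supp_swap hno f i j).trans hf
    · intro y f
      by_cases hf : supp hno f = S
      · rw [if_pos hf, pull_pos _ _ _ hf]
        have hfe := hDU f hf
        choose a ha using hfe
        rw [pull_pos]
        · congr 1
          funext j
          simp only [Function.comp_apply]
          rw [← ha, hσ, hψ]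
        · intro j
          simp only [Function.comp_apply]
          rw [← ha, hσ]
          exact ⟨_, rfl⟩
      · rw [if_neg hf, pull_neg _ _ _ hf]
  · refine ⟨0, 0, fun i _ x => by simp, fun i _ x => by simp, fun y f => ?_⟩
    rw [if_neg (fun h => hS ⟨f, h⟩)]
    simp

theorem retract (Q q : k) {m n d : ℕ} (hmn : m ≤ n) (hmo : Odd m) (hno : Odd n) :
    ∃ (I : ((Fin d → Fin m) → k) →ₗ[k] ((Fin d → Fin n) → k))
      (P : ((Fin d → Fin n) → k) →ₗ[k] ((Fin d → Fin m) → k)),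
      Tw Q q n m d I ∧ Tw Q q m n d P ∧ ∀ x, P (I x) = x := by
  have ht := cen_mono hmn
  have htr := cen_rev hmn hmo hno
  obtain ⟨ψ, hψ, hB⟩ := span_tw (d := d) Q q hno.pos id _ strictMono_id ht (fun _ => rfl) htr
  obtain ⟨σ, hσ, hA⟩ := span_tw (d := d) Q q hmo.pos _ id ht strictMono_id htr (fun _ => rfl)
  refine ⟨pull k σ {g | ∀ j, g j ∈ Set.range (cen hmn)}, pull k ψ Set.univ,
    hA _ (fun g hg => hg) (range_D _ htr).1 (range_D _ htr).2,
    hB _ (fun g _ j => ⟨g j, rfl⟩) (fun _ _ _ => trivial) (fun _ _ _ _ => trivial), ?_⟩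
  intro x
  funext g
  simp only [id] at hψ hσ
  rw [pull_pos _ _ _ (Set.mem_univ g), pull_pos]
  · congr 1
    funext j
    simp only [Function.comp_apply]
    rw [hψ, hσ]
  · intro j
    simp only [Function.comp_apply]
    rw [hψ]
    exact ⟨_, rfl⟩

theorem mem_schur (Q q : k) (n d : ℕ) (s : Module.End k ((Fin d → Fin n) → k)) :
    s ∈ schurB Q q n d ↔ Tw Q q n n d s := by
  unfold schurB Tw
  rw [Subalgebra.mem_centralizer_iff]
  simp only [Set.forall_mem_image, Set.mem_Iio]
  refine forall_congr' fun i => imp_congr_right fun _ => ?_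
  rw [LinearMap.ext_iff]
  exact forall_congr' fun x => eq_comm

theorem Tw.comp {Q q : k} {l m n d : ℕ} {A : ((Fin d → Fin m) → k) →ₗ[k] ((Fin d → Fin l) → k)}
    {B : ((Fin d → Fin n) → k) →ₗ[k] ((Fin d → Fin m) → k)} (hA : Tw Q q l m d A)
    (hB : Tw Q q m n d B) : Tw Q q l n d (A ∘ₗ B) := by
  intro i hi x
  rw [LinearMap.comp_apply, LinearMap.comp_apply, hB i hi, hA i hi]

end intertwine

section morita
variable {R S : Type u} [Ring R] [Ring S] (j : S →ₙ+* R)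

/-- the functor's object part -/
def cutSub (M : Type u) [AddCommGroup M] [Module R M] : AddSubgroup M where
  carrier := {x | j 1 • x = x}
  add_mem' := by intro a b ha hb; simp only [Set.mem_ofPred_eq] at *; rw [smul_add, ha, hb]
  zero_mem' := by simp
  neg_mem' := by intro a ha; simp only [Set.mem_ofPred_eq] at *; rw [smul_neg, ha]

variable {j} in
theorem mem_cut {M : Type u} [AddCommGroup M] [Module R M] {x : M} :
    x ∈ cutSub j M ↔ j 1 • x = x := Iff.rfl

theorem j_smul_mem {M : Type u} [AddCommGroup M] [Module R M] (s : S) (x : M) :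
    j s • x ∈ cutSub j M := by
  rw [mem_cut, ← mul_smul, ← map_mul, one_mul]

instance cutModule (M : Type u) [AddCommGroup M] [Module R M] : Module S (cutSub j M) where
  smul s x := ⟨j s • (x : M), j_smul_mem j s _⟩
  one_smul x := Subtype.ext x.2
  mul_smul a b x := Subtype.ext (by
    change j (a * b) • (x : M) = j a • j b • (x : M)
    rw [map_mul, mul_smul])
  smul_zero a := Subtype.ext (smul_zero (j a))
  zero_smul x := Subtype.ext (by
    change j 0 • (x : M) = 0
    rw [map_zero, zero_smul])
  smul_add a x y := Subtype.ext (smul_add (j a) (x : M) y)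
  add_smul a b x := Subtype.ext (by
    change j (a + b) • (x : M) = j a • (x : M) + j b • (x : M)
    rw [map_add, add_smul])

theorem cut_smul_coe {M : Type u} [AddCommGroup M] [Module R M] (s : S) (x : cutSub j M) :
    ((s • x : cutSub j M) : M) = j s • (x : M) := rfl

def cutMap {M N : Type u} [AddCommGroup M] [Module R M] [AddCommGroup N] [Module R N]
    (f : M →ₗ[R] N) : cutSub j M →ₗ[S] cutSub j N where
  toFun x := ⟨f x, by rw [mem_cut, ← map_smul, mem_cut.1 x.2]⟩
  map_add' x y := Subtype.ext (by simp)
  map_smul' s x := Subtype.ext (by simp [cut_smul_coe])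

open CategoryTheory in
def cutFunctor : ModuleCat.{u} R ⥤ ModuleCat.{u} S where
  obj M := ModuleCat.of S (cutSub j M)
  map f := ModuleCat.ofHom (cutMap j f.hom)
  map_id _ := by ext x; rfl
  map_comp _ _ := by ext x; rfl

/-- left ideal-like right module `eR` as left `S`-module. -/
abbrev eR : Type u := cutSub j R

def rmulR (r : R) : eR j →ₗ[S] eR j where
  toFun x := ⟨(x : R) * r, by
    rw [mem_cut, smul_eq_mul, ← mul_assoc, ← smul_eq_mul (j 1), mem_cut.1 x.2]⟩
  map_add' x y := Subtype.ext (by simp [add_mul])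
  map_smul' s x := Subtype.ext (by simp [cut_smul_coe, mul_assoc])

theorem rmulR_coe (r : R) (x : eR j) : (rmulR j r x : R) = x * r := rfl

variable (N : Type u) [AddCommGroup N] [Module S N]

def Ind : Type u := eR j →ₗ[S] N

instance : AddCommGroup (Ind j N) := inferInstanceAs (AddCommGroup (eR j →ₗ[S] N))

instance : Module R (Ind j N) where
  smul r φ := LinearMap.comp (show eR j →ₗ[S] N from φ) (rmulR j r)
  one_smul φ := LinearMap.ext fun x => congrArg (show eR j →ₗ[S] N from φ)
    (Subtype.ext (by simp [rmulR_coe]))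
  mul_smul a b φ := LinearMap.ext fun x => congrArg (show eR j →ₗ[S] N from φ)
    (Subtype.ext (by simp [rmulR_coe, mul_assoc]))
  smul_zero a := LinearMap.ext fun x => rfl
  zero_smul φ := LinearMap.ext fun x =>
    (congrArg (show eR j →ₗ[S] N from φ) (Subtype.ext (by simp [rmulR_coe]))).trans
      (map_zero (show eR j →ₗ[S] N from φ))
  smul_add a x y := LinearMap.ext fun x => rfl
  add_smul a b φ := LinearMap.ext fun x =>
    (congrArg (show eR j →ₗ[S] N from φ) (Subtype.ext (by simp [rmulR_coe, mul_add]))).trans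
      (map_add (show eR j →ₗ[S] N from φ) (rmulR j a x) (rmulR j b x))

def Ind.ap {N : Type u} [AddCommGroup N] [Module S N] (φ : Ind j N) : eR j →ₗ[S] N := φ

theorem Ind.ap_smul (r : R) (φ : Ind j N) (x : eR j) :
    Ind.ap j (r • φ) x = Ind.ap j φ (rmulR j r x) := rfl

theorem Ind.ap_add (φ ψ : Ind j N) (x : eR j) :
    Ind.ap j (φ + ψ) x = Ind.ap j φ x + Ind.ap j ψ x := rfl

def jj (s : S) : eR j := ⟨j s, by rw [mem_cut, smul_eq_mul, ← map_mul, one_mul]⟩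

theorem ess_iso (hinj : Function.Injective j) (hsurj : ∀ r : R, ∃ s, j s = j 1 * r * j 1) : Nonempty (cutSub j (Ind j N) ≃ₗ[S] N) := by
  choose π hπ using hsurj
  have hπj : ∀ s, π (j s) = s := fun s => hinj (by
    rw [hπ, ← map_mul, ← map_mul, one_mul, mul_one])
  have hee : j 1 * j 1 = j 1 := by rw [← map_mul, one_mul]
  let F : cutSub j (Ind j N) →ₗ[S] N :=
    { toFun := fun φ => Ind.ap j φ.1 (jj j 1)
      map_add' := fun φ ψ => rfl
      map_smul' := fun s φ => by
        rw [cut_smul_coe, Ind.ap_smul, RingHom.id_apply, ← map_smul]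
        congr 1
        apply Subtype.ext
        rw [rmulR_coe, cut_smul_coe, smul_eq_mul]
        simp only [jj]
        rw [← map_mul, ← map_mul, one_mul, mul_one] }
  refine ⟨LinearEquiv.ofBijective F ⟨?_, ?_⟩⟩
  · rw [injective_iff_map_eq_zero]
    intro φ hφ
    apply Subtype.ext
    apply LinearMap.ext
    intro x
    have h1 : Ind.ap j (φ : Ind j N) x = Ind.ap j φ.1 (rmulR j (j 1) x) := by
      conv_lhs => rw [← mem_cut.1 φ.2]
      rfl
    have h2 : rmulR j (j 1) x = π x • jj j 1 := by
      apply Subtype.ext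
      have := mem_cut.1 x.2
      rw [smul_eq_mul] at this
      rw [rmulR_coe, cut_smul_coe, smul_eq_mul, hπ, this]
      simp only [jj]
      rw [mul_assoc, hee]
    rw [h2, map_smul] at h1
    change Ind.ap j φ.1 (jj j 1) = 0 at hφ
    rw [hφ, smul_zero] at h1
    exact h1
  · intro y
    let φ : Ind j N := show eR j →ₗ[S] N from
      { toFun := fun x => π x • y
        map_add' := fun a b => by
          rw [← add_smul]; congr 1; apply hinj
          rw [map_add, hπ, hπ, hπ]; simp [mul_add, add_mul]
        map_smul' := fun s a => by
          rw [RingHom.id_apply, ← mul_smul]; congr 1; apply hinj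
          rw [map_mul, hπ, hπ, cut_smul_coe, smul_eq_mul]
          simp only [← mul_assoc]
          rw [← map_mul, ← map_mul, one_mul, mul_one] }
    have hφ : ∀ x, Ind.ap j φ x = π x • y := fun x => rfl
    refine ⟨⟨φ, ?_⟩, ?_⟩
    · rw [mem_cut]
      apply LinearMap.ext
      intro x
      change Ind.ap j (j 1 • φ) x = Ind.ap j φ x
      rw [Ind.ap_smul, hφ, hφ]
      congr 1
      apply hinj
      rw [hπ, hπ, rmulR_coe, mul_assoc, mul_assoc, hee, mul_assoc]
    · change Ind.ap j φ (jj j 1) = y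
      rw [hφ]
      simp only [jj]
      rw [hπj, one_smul]

theorem morita_full (hinj : Function.Injective j) (hsurj : ∀ r : R, ∃ s, j s = j 1 * r * j 1)
    {ι : Type*} [Fintype ι] (a b : ι → R) (hab : ∑ i, a i * j 1 * b i = 1) :
    Nonempty (ModuleCat.{u} R ≌ ModuleCat.{u} S) := by
  have key : ∀ (M : ModuleCat.{u} R) (x : M), x = ∑ i, a i • j 1 • b i • x := by
    intro M x
    conv_lhs => rw [← one_smul R x, ← hab, Finset.sum_smul]
    simp only [mul_smul]
  have hF : (cutFunctor j).Faithful := ⟨by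
    intro M N f g h
    ext x
    have h' : ∀ y : cutSub j M, f.hom y = g.hom y := fun y => by
      have := congrArg (fun t => ((t.hom y : cutSub j N) : N)) h
      exact this
    rw [key M x]
    simp only [map_sum]
    refine Finset.sum_congr rfl fun i _ => ?_
    rw [map_smul f.hom (a i), map_smul g.hom (a i)]
    congr 1
    exact h' ⟨_, j_smul_mem j 1 _⟩⟩
  have hFull : (cutFunctor j).Full := ⟨by
    intro M N g
    let c : M → R → cutSub j M := fun x r => ⟨j 1 • r • x, j_smul_mem j 1 _⟩
    let g' : cutSub j M →ₗ[S] cutSub j N := g.hom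
    have hc : ∀ (s : S) (y : cutSub j M), (g' (s • y) : N) = j s • (g' y : N) := fun s y => by
      rw [map_smul]; rfl
    have hcr : ∀ (r : R) (x : M), c (r • x) = fun r' => c x (r' * r) := fun r x => by
      funext r'; apply Subtype.ext; simp [c, mul_smul]
    have hmain : ∀ (x : M) (r : R), ∑ i, a i • (g' (c x (b i * r)) : N)
        = r • ∑ i, a i • (g' (c x (b i)) : N) := by
      intro x r
      have h1 : ∀ r', (g' (c x r') : N) =
          ∑ l, (j 1 * r' * a l * j 1) • (g' (c x (b l)) : N) := by
        intro r'
        have : c x r' = ∑ l, (Classical.choose (hsurj (r' * a l))) • c x (b l) := by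
          apply Subtype.ext
          rw [AddSubgroup.val_finsetSum]
          simp only [cut_smul_coe, Classical.choose_spec (hsurj _)]
          simp only [c]
          conv_lhs => rw [key M x]
          simp only [Finset.smul_sum]
          refine Finset.sum_congr rfl fun i _ => ?_
          simp only [← mul_smul]
          congr 1
          simp only [← mul_assoc]
          rw [mul_assoc _ (j 1) (j 1), ← map_mul, one_mul]
        rw [this, map_sum, AddSubgroup.val_finsetSum]
        refine Finset.sum_congr rfl fun i _ => ?_
        rw [hc, Classical.choose_spec (hsurj _)]
        simp only [mul_assoc]
      have h2 : ∀ r, ∑ i, a i • (g' (c x (b i * r)) : N) =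
          ∑ l, (r * a l * j 1) • (g' (c x (b l)) : N) := by
        intro r
        conv_lhs =>
          enter [2, i]
          rw [h1]
        simp only [Finset.smul_sum]
        rw [Finset.sum_comm]
        refine Finset.sum_congr rfl fun l _ => ?_
        simp only [← mul_smul]
        rw [← Finset.sum_smul]
        congr 1
        calc ∑ i, a i * (j 1 * (b i * r) * a l * j 1)
            = (∑ i, a i * j 1 * b i) * (r * a l * j 1) := by
              rw [Finset.sum_mul]
              exact Finset.sum_congr rfl fun i _ => by simp only [mul_assoc]
          _ = _ := by rw [hab, one_mul]
      rw [h2, Finset.smul_sum]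
      refine Finset.sum_congr rfl fun l _ => ?_
      rw [mul_assoc, mul_smul, mul_smul, mem_cut.1 (g' (c x (b l))).2]
    let f : M →ₗ[R] N :=
      { toFun := fun x => ∑ i, a i • (g' (c x (b i)) : N)
        map_add' := fun x y => by
          rw [← Finset.sum_add_distrib]
          refine Finset.sum_congr rfl fun i _ => ?_
          rw [← smul_add, ← AddSubgroup.coe_add, ← map_add]
          congr 3
          apply Subtype.ext
          simp [c]
        map_smul' := fun r x => by
          simp only [hcr, RingHom.id_apply]
          exact hmain x r }
    refine ⟨ModuleCat.ofHom f, ?_⟩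
    ext y0
    apply Subtype.ext
    let y : cutSub j M := y0
    change ∑ i, a i • (g' (c y.1 (b i)) : N) = (g' y : N)
    have hy : ∀ r, (g' (c y.1 r) : N) = (j 1 * r * j 1) • (g' y : N) := by
      intro r
      have : c y.1 r = (Classical.choose (hsurj r)) • y := by
        apply Subtype.ext
        rw [cut_smul_coe, Classical.choose_spec (hsurj _)]
        simp only [c, mul_smul]
        rw [mem_cut.1 y.2]
      rw [this, hc, Classical.choose_spec (hsurj _)]
    simp only [hy, mul_smul, mem_cut.1 (g' y).2]
    exact (key N _).symm⟩
  have hE : (cutFunctor j).EssSurj := ⟨fun N => by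
    obtain ⟨e⟩ := ess_iso j N hinj hsurj
    exact ⟨ModuleCat.of R (Ind j N), ⟨e.toModuleIso⟩⟩⟩
  have : (cutFunctor j).IsEquivalence := { }
  exact ⟨(cutFunctor j).asEquivalence⟩
end morita


theorem morita_le {k : Type u} [Field k]
    (Q q : k) (d m n : ℕ) (hm : 2 * d ≤ m) (hmo : Odd m) (hno : Odd n) (hmn : m ≤ n) :
    Nonempty (ModuleCat.{u} ↥(schurB Q q n d) ≌ ModuleCat.{u} ↥(schurB Q q m d)) := by
  obtain ⟨I, P, hI, hP, hPI⟩ := retract (d := d) Q q hmn hmo hno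
  choose A B hA hB hAB using piece (d := d) (n := n) Q q hm hmo hno
  let j : schurB Q q m d →ₙ+* schurB Q q n d :=
    { toFun := fun s => ⟨I ∘ₗ s.1 ∘ₗ P, (mem_schur _ _ _ _ _).2
        (hI.comp (((mem_schur _ _ _ _ _).1 s.2).comp hP))⟩
      map_mul' := fun s t => Subtype.ext (LinearMap.ext fun x => by simp [hPI])
      map_zero' := Subtype.ext (LinearMap.ext fun x => by simp)
      map_add' := fun s t => Subtype.ext (LinearMap.ext fun x => by simp) }
  have hj : ∀ s x, (j s).1 x = I (s.1 (P x)) := fun s x => rfl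
  refine morita_full j ?_ ?_ (ι := Finset (Fin n))
    (fun S => ⟨A S ∘ₗ P, (mem_schur _ _ _ _ _).2 ((hA S).comp hP)⟩)
    (fun S => ⟨I ∘ₗ B S, (mem_schur _ _ _ _ _).2 (hI.comp (hB S))⟩) ?_
  · intro s t hst
    apply Subtype.ext
    apply LinearMap.ext
    intro x
    have : (j s).1 (I x) = (j t).1 (I x) := by rw [hst]
    rw [hj, hj, hPI] at this
    have := congrArg P this
    rwa [hPI, hPI] at this
  · intro r
    refine ⟨⟨P ∘ₗ r.1 ∘ₗ I, (mem_schur _ _ _ _ _).2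
        (hP.comp (((mem_schur _ _ _ _ _).1 r.2).comp hI))⟩, ?_⟩
    apply Subtype.ext
    apply LinearMap.ext
    intro x
    rfl
  · apply Subtype.ext
    apply LinearMap.ext
    intro x
    funext f
    rw [AddSubmonoidClass.coe_finsetSum, LinearMap.sum_apply, Finset.sum_apply]
    have : ∀ S : Finset (Fin n), A S (P (I (P (I (B S x))))) f
        = if supp hno f = S then x f else 0 := by
      intro S
      rw [hPI, hPI, hAB]
    refine (Finset.sum_congr rfl fun S _ => this S).trans ?_
    simp

/-- If `m, n ≥ 2d` are odd, then the type B Schur algebras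
`S^B_{Q,q}(m; d)` and `S^B_{Q,q}(n; d)` are Morita equivalent: their categories
of modules are equivalent. -/
theorem schur_morita_odd {k : Type u} [Field k]
    (Q q : k) (hQ : Q ≠ 0) (hq : q ≠ 0) (d : ℕ) (hd : 1 ≤ d)
    (m n : ℕ) (hm : 2 * d ≤ m) (hn : 2 * d ≤ n) (hmo : Odd m) (hno : Odd n) :
    Nonempty (ModuleCat.{u} ↥(schurB Q q m d) ≌ ModuleCat.{u} ↥(schurB Q q n d)) := by
  rcases le_total m n with h | h
  · obtain ⟨e⟩ := morita_le Q q d m n hm hmo hno h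
    exact ⟨e.symm⟩
  · exact morita_le Q q d n m hn hno hmo h

end QSP
end
end

section
/- Assume k = ℂ and Q, q are generic. Then for every m ≥ 1, the ℋ^B_{Q,q}(d)-module V_{2m−1}^{⊗d} is a direct summand of a finite direct sum of copies of V_{2m}^{⊗d}: there exist N ≥ 1 and ℂ-linear maps ι : V_{2m−1}^{⊗d} → (V_{2m}^{⊗d})^{⊕N} and π : (V_{2m}^{⊗d})^{⊕N} → V_{2m−1}^{⊗d}, each intertwining the operators T_0, …, T_{d−1} (acting diagonally on the direct sum), with π ∘ ι = Id. -/
noncomputable section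
namespace QSP

variable {k : Type*} [Field k]

def TBK (Q : k) (n d : ℕ) (hd : 0 < d) : Matrix (Fin d → Fin n) (Fin d → Fin n) k :=
  fun c b =>
    if ∀ j, j ≠ (⟨0, hd⟩ : Fin d) → c j = b j then
      KQmat Q n (c ⟨0, hd⟩) (b ⟨0, hd⟩) else 0

def TBR (q : k) (n d i : ℕ) (hi : i < d) : Matrix (Fin d → Fin n) (Fin d → Fin n) k :=
  fun c b =>
      if ∀ j, j ≠ (⟨i - 1, Nat.lt_of_le_of_lt (Nat.pred_le i) hi⟩ : Fin d) →
          j ≠ (⟨i, hi⟩ : Fin d) → c j = b j then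
        Rmat q n (c ⟨i - 1, Nat.lt_of_le_of_lt (Nat.pred_le i) hi⟩, c ⟨i, hi⟩)
          (b ⟨i - 1, Nat.lt_of_le_of_lt (Nat.pred_le i) hi⟩, b ⟨i, hi⟩) else 0

def TBm (Q q : k) (n d : ℕ) (i : ℕ) : Matrix (Fin d → Fin n) (Fin d → Fin n) k :=
  if _h0 : i = 0 then
    if hd : 0 < d then TBK Q n d hd else 0
  else if hi : i < d then TBR q n d i hi else 0

lemma TB_eq (Q q : k) (n d i : ℕ) : TB Q q n d i = Matrix.toLin' (TBm Q q n d i) := by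
  unfold TB TBm
  by_cases h0 : i = 0
  · by_cases hd : 0 < d
    · simp only [dif_pos h0, dif_pos hd]; rfl
    · simp only [dif_pos h0, dif_neg hd, map_zero]
  · by_cases hi : i < d
    · simp only [dif_neg h0, dif_pos hi]; rfl
    · simp only [dif_neg h0, dif_neg hi, map_zero]

lemma KQ_symm (Q : k) (n : ℕ) (a b : Fin n) : KQmat Q n a b = KQmat Q n b a := by
  have h1 : a = Fin.rev b ↔ b = Fin.rev a := by
    constructor <;> (rintro rfl; simp)
  by_cases hab : a = b
  · subst hab; rfl
  · have hba : ¬ b = a := fun h => hab h.symm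
    unfold KQmat
    simp only [hab, hba, h1, and_false, if_false, add_zero]
    have h2 : b = Fin.rev a → val n a ≠ 0 ∧ val n b ≠ 0 := by
      intro h
      have : (b : ℕ) ≠ a := fun h => hba (Fin.ext h)
      have h' : (b : ℕ) = n - (a + 1) := by rw [h, Fin.val_rev]
      unfold val; omega
    by_cases h : b = Fin.rev a
    · rw [if_neg (h2 h).1, if_neg (h2 h).2]
    · simp [h]

lemma R_symm (q : k) (n : ℕ) (a b : Fin n × Fin n) : Rmat q n a b = Rmat q n b a := by
  obtain ⟨a1, a2⟩ := a
  obtain ⟨b1, b2⟩ := b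
  unfold Rmat
  simp only [Prod.mk.injEq]
  grind

lemma TBm_symm (Q q : k) (n d i : ℕ) : (TBm Q q n d i).transpose = TBm Q q n d i := by
  ext c b
  rw [Matrix.transpose_apply]
  unfold TBm
  by_cases h0 : i = 0
  · by_cases hd : 0 < d
    · rw [dif_pos h0, dif_pos hd]
      simp only [TBK, KQ_symm Q n (b _)]
      congr 1
      exact propext ⟨fun h j hj => (h j hj).symm, fun h j hj => (h j hj).symm⟩
    · rw [dif_pos h0, dif_neg hd]; rfl
  · by_cases hi : i < d
    · rw [dif_neg h0, dif_pos hi]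
      simp only [TBR, R_symm q n (b _, b _)]
      congr 1
      exact propext ⟨fun h j hj hj' => (h j hj hj').symm, fun h j hj hj' => (h j hj hj').symm⟩
    · rw [dif_neg h0, dif_neg hi]; rfl

lemma TB_zero_apply (Q q : k) (n d : ℕ) (hd : 0 < d) (x : (Fin d → Fin n) → k)
    (c : Fin d → Fin n) :
    TB Q q n d 0 x c =
      if val n (c ⟨0, hd⟩) = 0 then Q⁻¹ * x c
      else x (Function.update c ⟨0, hd⟩ (Fin.rev (c ⟨0, hd⟩))) +
        (if val n (c ⟨0, hd⟩) < 0 then (Q⁻¹ - Q) * x c else 0) := by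
  classical
  have key : ∀ b : Fin d → Fin n, TBm Q q n d 0 c b =
      if val n (c ⟨0, hd⟩) = 0 then (if b = c then Q⁻¹ else 0)
      else (if b = Function.update c ⟨0, hd⟩ (Fin.rev (c ⟨0, hd⟩)) then 1 else 0) +
        (if val n (c ⟨0, hd⟩) < 0 then (if b = c then Q⁻¹ - Q else 0) else 0) := by
    intro b
    have e1 : b = c ↔ (∀ j, j ≠ (⟨0, hd⟩ : Fin d) → c j = b j) ∧ b ⟨0, hd⟩ = c ⟨0, hd⟩ := by
      constructor
      · rintro rfl; simp
      · rintro ⟨h, h'⟩; funext j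
        by_cases hj : j = ⟨0, hd⟩
        · rw [hj, h']
        · exact (h j hj).symm
    have e2 : b = Function.update c ⟨0, hd⟩ (Fin.rev (c ⟨0, hd⟩)) ↔
        (∀ j, j ≠ (⟨0, hd⟩ : Fin d) → c j = b j) ∧ b ⟨0, hd⟩ = Fin.rev (c ⟨0, hd⟩) := by
      constructor
      · rintro rfl
        refine ⟨fun j hj => ?_, by simp⟩
        rw [Function.update_of_ne hj]
      · rintro ⟨h, h'⟩; funext j
        by_cases hj : j = ⟨0, hd⟩
        · rw [hj, h']; simp
        · rw [Function.update_of_ne hj]; exact (h j hj).symm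
    simp only [e1, e2]
    simp only [TBm, dif_pos, hd, TBK]
    rw [KQ_symm]
    unfold KQmat
    clear e1 e2
    by_cases hP : ∀ j, j ≠ (⟨0, hd⟩ : Fin d) → c j = b j
    · simp only [if_pos hP, eq_true hP, true_and]
      split_ifs <;> first | rfl | (exfalso; tauto) | simp
    · simp only [if_neg hP, eq_false hP, false_and, if_false]
      simp
  rw [TB_eq, Matrix.toLin'_apply]
  simp only [Matrix.mulVec, dotProduct, key]
  split_ifs <;> simp [add_mul, Finset.sum_add_distrib]

lemma TB_pos_apply (Q q : k) (n d i : ℕ) (h0 : i ≠ 0) (hi : i < d) (s t : Fin d)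
    (hs : (s : ℕ) = i - 1) (ht : (t : ℕ) = i) (x : (Fin d → Fin n) → k)
    (c : Fin d → Fin n) :
    TB Q q n d i x c =
      if c s = c t then q⁻¹ * x c
      else x (c ∘ Equiv.swap s t) +
        (if c t < c s then (q⁻¹ - q) * x c else 0) := by
  classical
  have hst : s ≠ t := by intro h; rw [h] at hs; omega
  have key : ∀ b : Fin d → Fin n, TBm Q q n d i c b =
      if c s = c t then (if b = c then q⁻¹ else 0)
      else (if b = c ∘ Equiv.swap s t then 1 else 0) +
        (if c t < c s then (if b = c then q⁻¹ - q else 0) else 0) := by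
    intro b
    have e1 : b = c ↔ (∀ j, j ≠ s → j ≠ t → c j = b j) ∧ b s = c s ∧ b t = c t := by
      constructor
      · rintro rfl; simp
      · rintro ⟨h, h', h''⟩; funext j
        by_cases hj : j = s
        · rw [hj, h']
        by_cases hj' : j = t
        · rw [hj', h'']
        · exact (h j hj hj').symm
    have e2 : b = c ∘ Equiv.swap s t ↔
        (∀ j, j ≠ s → j ≠ t → c j = b j) ∧ b s = c t ∧ b t = c s := by
      constructor
      · rintro rfl
        refine ⟨fun j hj hj' => ?_, by simp, by simp⟩
        simp [Equiv.swap_apply_of_ne_of_ne hj hj']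
      · rintro ⟨h, h', h''⟩; funext j
        by_cases hj : j = s
        · rw [hj, h']; simp
        by_cases hj' : j = t
        · rw [hj', h'']; simp
        · simp [Equiv.swap_apply_of_ne_of_ne hj hj', h j hj hj']
    have es : (⟨i - 1, Nat.lt_of_le_of_lt (Nat.pred_le i) hi⟩ : Fin d) = s := Fin.ext hs.symm
    have et : (⟨i, hi⟩ : Fin d) = t := Fin.ext ht.symm
    simp only [e1, e2]
    simp only [TBm, dif_neg h0, dif_pos hi, TBR, es, et]
    rw [R_symm]
    unfold Rmat
    simp only [Prod.mk.injEq]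
    clear e1 e2
    by_cases hP : ∀ j, j ≠ s → j ≠ t → c j = b j
    · simp only [if_pos hP, eq_true hP, true_and]
      clear hP
      grind
    · simp only [if_neg hP, eq_false hP, false_and, if_false]
      simp
  rw [TB_eq, Matrix.toLin'_apply]
  simp only [Matrix.mulVec, dotProduct, key]
  split_ifs <;> simp [add_mul, Finset.sum_add_distrib]

/-- collapse map -/
def kap (m : ℕ) (hm : 1 ≤ m) (j : Fin (2 * m)) : Fin (2 * m - 1) :=
  ⟨if (j : ℕ) < m then j else j - 1, by split_ifs <;> omega⟩

def gg (Q : k) (m : ℕ) (j : Fin (2 * m)) : k := if (j : ℕ) + 1 = m then Q⁻¹ else 1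

def hh (q : k) (m : ℕ) (i j : Fin (2 * m)) : k :=
  if ((i : ℕ) + 1 = m ∨ (i : ℕ) = m) ∧ (j : ℕ) + 1 = m then q⁻¹ else 1

def coef (Q q : k) (m d : ℕ) (c : Fin d → Fin (2 * m)) : k :=
  (∏ p, gg Q m (c p)) * ∏ p : Fin d × Fin d, if p.1 < p.2 then hh q m (c p.1) (c p.2) else 1

lemma coef_swap (Q q : k) (m d : ℕ) (c : Fin d → Fin (2 * m)) (s t : Fin d)
    (hst : (s : ℕ) + 1 = t) :
    coef Q q m d (c ∘ Equiv.swap s t) * hh q m (c s) (c t) =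
      coef Q q m d c * hh q m (c t) (c s) := by
  classical
  have hne : s ≠ t := by intro h; rw [h] at hst; omega
  have hlt : s < t := by rw [Fin.lt_def]; omega
  have e1 : ∏ p, gg Q m ((c ∘ Equiv.swap s t) p) = ∏ p, gg Q m (c p) :=
    Equiv.prod_comp (Equiv.swap s t) (fun p => gg Q m (c p))
  have split : ∀ c' : Fin d → Fin (2 * m),
      (∏ p : Fin d × Fin d, if p.1 < p.2 then hh q m (c' p.1) (c' p.2) else 1) =
      hh q m (c' s) (c' t) *
      ∏ p : Fin d × Fin d, if p.1 < p.2 ∧ p ≠ (s, t) then hh q m (c' p.1) (c' p.2) else 1 := by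
    intro c'
    have : hh q m (c' s) (c' t) = ∏ p : Fin d × Fin d,
        if p = (s, t) then hh q m (c' p.1) (c' p.2) else 1 := by
      rw [Finset.prod_ite_eq']; simp
    rw [this, ← Finset.prod_mul_distrib]
    refine Finset.prod_congr rfl fun p _ => ?_
    by_cases hp : p = (s, t)
    · subst hp; simp [hlt]
    · simp [hp]
  have inv : (∏ p : Fin d × Fin d, if p.1 < p.2 ∧ p ≠ (s, t) then
      hh q m ((c ∘ Equiv.swap s t) p.1) ((c ∘ Equiv.swap s t) p.2) else 1) =
      ∏ p : Fin d × Fin d, if p.1 < p.2 ∧ p ≠ (s, t) then hh q m (c p.1) (c p.2) else 1 := by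
    rw [← Equiv.prod_comp (Equiv.prodCongr (Equiv.swap s t) (Equiv.swap s t))
      (fun p : Fin d × Fin d => if p.1 < p.2 ∧ p ≠ (s, t) then hh q m (c p.1) (c p.2) else 1)]
    refine Finset.prod_congr rfl fun p _ => ?_
    obtain ⟨a, b⟩ := p
    simp only [Equiv.prodCongr_apply, Prod.map_apply, Function.comp_apply]
    congr 1
    apply propext
    simp only [Equiv.swap_apply_def, ne_eq, Prod.mk.injEq, Fin.ext_iff, Fin.lt_def]
    split_ifs <;> omega
  unfold coef
  rw [e1, split, split c, inv]
  simp only [Function.comp_apply, Equiv.swap_apply_left, Equiv.swap_apply_right]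
  ring

lemma coef_rev (Q q : k) (m d : ℕ) (hd : 0 < d) (c : Fin d → Fin (2 * m)) :
    coef Q q m d (Function.update c ⟨0, hd⟩ (Fin.rev (c ⟨0, hd⟩))) * gg Q m (c ⟨0, hd⟩) =
      coef Q q m d c * gg Q m (Fin.rev (c ⟨0, hd⟩)) := by
  classical
  set z : Fin d := ⟨0, hd⟩ with hz
  have e2 : ∀ p : Fin d × Fin d, (if p.1 < p.2 then
      hh q m (Function.update c z (Fin.rev (c z)) p.1)
        (Function.update c z (Fin.rev (c z)) p.2) else 1) =
      if p.1 < p.2 then hh q m (c p.1) (c p.2) else 1 := by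
    rintro ⟨a, b⟩
    dsimp only
    split_ifs with h
    · have hb : b ≠ z := by
        intro hb; rw [hb, Fin.lt_def] at h; simp [hz] at h
      rw [Function.update_of_ne hb]
      by_cases ha : a = z
      · subst ha
        rw [Function.update_self]
        unfold hh
        congr 1
        rw [Fin.val_rev]
        apply propext
        have := (c z).2
        omega
      · rw [Function.update_of_ne ha]
    · rfl
  have e1 : ∀ c' : Fin d → Fin (2 * m), ∏ p, gg Q m (c' p) =
      gg Q m (c' z) * ∏ p ∈ Finset.univ.erase z, gg Q m (c' p) := fun c' =>
    (Finset.mul_prod_erase _ _ (Finset.mem_univ z)).symm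
  have e3 : ∏ p ∈ Finset.univ.erase z, gg Q m (Function.update c z (Fin.rev (c z)) p) =
      ∏ p ∈ Finset.univ.erase z, gg Q m (c p) := by
    refine Finset.prod_congr rfl fun p hp => ?_
    rw [Function.update_of_ne (Finset.ne_of_mem_erase hp)]
  unfold coef
  rw [e1, e1 c, e3]
  simp only [e2, Function.update_self]
  ring

def AA (Q q : k) (m d : ℕ) (hm : 1 ≤ m) :
    Matrix (Fin d → Fin (2 * m)) (Fin d → Fin (2 * m - 1)) k := fun c b =>
  if kap m hm ∘ c = b then coef Q q m d c else 0

lemma AA_apply (Q q : k) (m d : ℕ) (hm : 1 ≤ m) (x : (Fin d → Fin (2 * m - 1)) → k)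
    (c : Fin d → Fin (2 * m)) :
    Matrix.toLin' (AA Q q m d hm) x c = coef Q q m d c * x (kap m hm ∘ c) := by
  rw [Matrix.toLin'_apply]
  simp [Matrix.mulVec, dotProduct, AA]

lemma AA_inter (Q q : k) (hQ : Q ≠ 0) (hq : q ≠ 0) (m d : ℕ) (hm : 1 ≤ m) (i : ℕ) (hi : i < d)
    (x : (Fin d → Fin (2 * m - 1)) → k) :
    Matrix.toLin' (AA Q q m d hm) (TB Q q (2 * m - 1) d i x) =
      TB Q q (2 * m) d i (Matrix.toLin' (AA Q q m d hm) x) := by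
  funext c
  rw [AA_apply]
  by_cases h0 : i = 0
  · subst h0
    rw [TB_zero_apply _ _ _ _ hi, TB_zero_apply _ _ _ _ hi, AA_apply, AA_apply]
    have hc := coef_rev Q q m d hi c
    set z : Fin d := ⟨0, hi⟩ with hz
    have hk : kap m hm ∘ Function.update c z (Fin.rev (c z)) =
        Function.update (kap m hm ∘ c) z (Fin.rev (kap m hm (c z))) := by
      funext j
      by_cases hj : j = z
      · subst hj
        simp only [Function.comp_apply, Function.update_self, Fin.ext_iff, kap, Fin.val_rev]
        have := (c z).2
        split_ifs <;> omega
      · simp [Function.update_of_ne hj]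
    have hv : val (2 * m) (c z) ≠ 0 := by unfold val; omega
    rw [if_neg hv, hk]
    simp only [Function.comp_apply]
    by_cases hzero : val (2 * m - 1) (kap m hm (c z)) = 0
    · rw [if_pos hzero]
      have hk2 : Function.update (kap m hm ∘ c) z (Fin.rev (kap m hm (c z))) = kap m hm ∘ c := by
        rw [Function.update_eq_self_iff, Function.comp_apply, Fin.ext_iff, Fin.val_rev]
        unfold val at hzero
        omega
      rw [hk2]
      by_cases hneg : (c z : ℕ) + 1 = m
      · have : val (2 * m) (c z) < 0 := by unfold val; omega
        rw [if_pos this]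
        have h2 : gg Q m (Fin.rev (c z)) = 1 := by
          unfold gg; rw [Fin.val_rev, if_neg]; omega
        rw [h2, gg, if_pos hneg] at hc
        have : coef Q q m d (Function.update c z (Fin.rev (c z))) = coef Q q m d c * Q := by
          field_simp at hc; linear_combination hc
        rw [this]; ring
      · have hcz : (c z : ℕ) = m := by
          unfold val kap at hzero
          dsimp only at hzero
          split_ifs at hzero <;> omega
        have : ¬ val (2 * m) (c z) < 0 := by unfold val; omega
        rw [if_neg this]
        have h2 : gg Q m (Fin.rev (c z)) = Q⁻¹ := by
          unfold gg; rw [Fin.val_rev, if_pos]; omega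
        rw [h2, gg, if_neg hneg, mul_one] at hc
        rw [hc]; ring
    · rw [if_neg hzero]
      have hs : val (2 * m - 1) (kap m hm (c z)) < 0 ↔ val (2 * m) (c z) < 0 := by
        unfold val kap at *
        dsimp only at *
        split_ifs at * <;> omega
      have h1 : gg Q m (c z) = 1 := by
        unfold gg; rw [if_neg]
        unfold val kap at hzero
        dsimp only at hzero
        split_ifs at hzero <;> omega
      have h2 : gg Q m (Fin.rev (c z)) = 1 := by
        unfold gg; rw [Fin.val_rev, if_neg]
        unfold val kap at hzero
        dsimp only at hzero
        split_ifs at hzero <;> omega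
      rw [h1, h2, mul_one, mul_one] at hc
      simp only [hs, hc]
      split_ifs <;> ring
  · have hs1 : i - 1 < d := by omega
    rw [TB_pos_apply _ _ _ _ i h0 hi ⟨i - 1, hs1⟩ ⟨i, hi⟩ rfl rfl,
      TB_pos_apply _ _ _ _ i h0 hi ⟨i - 1, hs1⟩ ⟨i, hi⟩ rfl rfl, AA_apply, AA_apply]
    have hc := coef_swap Q q m d c ⟨i - 1, hs1⟩ ⟨i, hi⟩ (by simp; omega)
    generalize (⟨i - 1, hs1⟩ : Fin d) = s at *
    generalize (⟨i, hi⟩ : Fin d) = t at *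
    rw [← Function.comp_assoc]
    simp only [Function.comp_apply]
    by_cases he : c s = c t
    · simp only [he, if_true]; ring
    have he' : (c s : ℕ) ≠ c t := fun h => he (Fin.ext h)
    rw [if_neg he]
    by_cases hke : kap m hm (c s) = kap m hm (c t)
    · rw [if_pos hke]
      have hk2 : (kap m hm ∘ c) ∘ Equiv.swap s t = kap m hm ∘ c := by
        funext j
        simp only [Function.comp_apply, Equiv.swap_apply_def]
        split_ifs with h1 h2
        · rw [h1, hke]
        · rw [h2, hke]
        · rfl
      rw [hk2]
      have hke' := congrArg Fin.val hke
      unfold kap at hke'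
      dsimp only at hke'
      by_cases hlt : c t < c s
      · rw [if_pos hlt]
        rw [Fin.lt_def] at hlt
        have a1 : (c t : ℕ) + 1 = m ∧ (c s : ℕ) = m := by
          split_ifs at hke' <;> omega
        have b1 : hh q m (c s) (c t) = q⁻¹ := by unfold hh; rw [if_pos]; omega
        have b2 : hh q m (c t) (c s) = 1 := by unfold hh; rw [if_neg]; omega
        rw [b1, b2] at hc
        have : coef Q q m d (c ∘ Equiv.swap s t) = coef Q q m d c * q := by
          field_simp at hc; linear_combination hc
        rw [this]; ring
      · rw [if_neg hlt]
        rw [Fin.lt_def] at hlt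
        have a1 : (c s : ℕ) + 1 = m ∧ (c t : ℕ) = m := by
          split_ifs at hke' <;> omega
        have b1 : hh q m (c s) (c t) = 1 := by unfold hh; rw [if_neg]; omega
        have b2 : hh q m (c t) (c s) = q⁻¹ := by unfold hh; rw [if_pos]; omega
        rw [b1, b2, mul_one] at hc
        rw [hc]; ring
    · rw [if_neg hke]
      have hke' : ¬ (kap m hm (c s) : ℕ) = kap m hm (c t) := fun h => hke (Fin.ext h)
      have hs : kap m hm (c t) < kap m hm (c s) ↔ c t < c s := by
        rw [Fin.lt_def, Fin.lt_def]
        unfold kap at *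
        dsimp only at *
        split_ifs at * <;> omega
      have b1 : hh q m (c s) (c t) = 1 := by
        unfold hh; rw [if_neg]
        unfold kap at hke'
        dsimp only at hke'
        split_ifs at hke' <;> omega
      have b2 : hh q m (c t) (c s) = 1 := by
        unfold hh; rw [if_neg]
        unfold kap at hke'
        dsimp only at hke'
        split_ifs at hke' <;> omega
      rw [b1, b2, mul_one, mul_one] at hc
      simp only [hs, hc]
      split_ifs <;> ring

def ee (Q q : k) (m d : ℕ) (hm : 1 ≤ m) (b : Fin d → Fin (2 * m - 1)) : k :=
  ∑ c : Fin d → Fin (2 * m), if kap m hm ∘ c = b then coef Q q m d c ^ 2 else 0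

lemma AA_diag (Q q : k) (m d : ℕ) (hm : 1 ≤ m) :
    (AA Q q m d hm).transpose * AA Q q m d hm = Matrix.diagonal (ee Q q m d hm) := by
  ext b b'
  rw [Matrix.mul_apply, Matrix.diagonal_apply]
  simp only [Matrix.transpose_apply, AA, ee]
  split_ifs with h
  · subst h
    refine Finset.sum_congr rfl fun c _ => ?_
    split_ifs <;> ring
  · refine Finset.sum_eq_zero fun c _ => ?_
    split_ifs with h1 h2
    · exact absurd (h1.symm.trans h2) h
    all_goals simp

def zz (m d : ℕ) (b : Fin d → Fin (2 * m - 1)) (p : Fin d) : ℕ :=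
  (Finset.univ.filter fun r : Fin d => r < p ∧ (b r : ℕ) + 1 = m).card

def ff (Q q : k) (m d : ℕ) (b : Fin d → Fin (2 * m - 1)) (p : Fin d) (j : Fin (2 * m)) : k :=
  if (j : ℕ) + 1 = m then Q⁻¹ * q⁻¹ ^ zz m d b p else 1

lemma coef_eq (Q q : k) (m d : ℕ) (hm : 1 ≤ m) (c : Fin d → Fin (2 * m)) :
    coef Q q m d c = ∏ p, ff Q q m d (kap m hm ∘ c) p (c p) := by
  unfold coef
  rw [Fintype.prod_prod_type_right, ← Finset.prod_mul_distrib]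
  refine Finset.prod_congr rfl fun p _ => ?_
  unfold ff gg
  by_cases h : (c p : ℕ) + 1 = m
  · rw [if_pos h, if_pos h, zz, Finset.card_eq_sum_ones, ← Finset.prod_pow_eq_pow_sum,
      Finset.prod_filter]
    congr 1
    refine Finset.prod_congr rfl fun r _ => ?_
    have : ((kap m hm ∘ c) r : ℕ) + 1 = m ↔ ((c r : ℕ) + 1 = m ∨ (c r : ℕ) = m) := by
      simp only [Function.comp_apply, kap]
      split_ifs <;> omega
    simp only [this]
    unfold hh
    simp only [h, and_true, pow_one]
    split_ifs <;> simp_all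
  · rw [if_neg h, if_neg h, one_mul]
    refine Finset.prod_eq_one fun r _ => ?_
    simp [hh, h]

lemma ee_eq (Q q : k) (m d : ℕ) (hm : 1 ≤ m) (b : Fin d → Fin (2 * m - 1)) :
    ee Q q m d hm b =
      ∏ p, ∑ j, if kap m hm j = b p then ff Q q m d b p j ^ 2 else 0 := by
  classical
  rw [Fintype.prod_sum]
  unfold ee
  refine Finset.sum_congr rfl fun c _ => ?_
  split_ifs with h
  · rw [coef_eq Q q m d hm, h, ← Finset.prod_pow]
    refine Finset.prod_congr rfl fun p _ => ?_
    exact (if_pos (congrFun h p)).symm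
  · symm
    have : ∃ p, kap m hm (c p) ≠ b p := by
      by_contra! h'
      exact h (funext h')
    obtain ⟨p, hp⟩ := this
    exact Finset.prod_eq_zero (Finset.mem_univ p) (if_neg hp)

lemma ee_ne (Q q : ℂ) 
    (hgen : ∀ a b : ℤ, (a, b) ≠ (0, 0) → Q ^ a * q ^ b ≠ 1)
    (m d : ℕ) (hm : 1 ≤ m) (b : Fin d → Fin (2 * m - 1)) :
    ee Q q m d hm b ≠ 0 := by
  classical
  rw [ee_eq]
  refine Finset.prod_ne_zero_iff.mpr fun p _ => ?_
  have hb := (b p).2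
  by_cases h : (b p : ℕ) + 1 = m
  · have h1 : m - 1 < 2 * m := by omega
    have h2 : m < 2 * m := by omega
    rw [Finset.sum_eq_add_of_mem (⟨m - 1, h1⟩ : Fin (2 * m)) ⟨m, h2⟩ (Finset.mem_univ _)
      (Finset.mem_univ _)]
    · have k1 : kap m hm ⟨m - 1, h1⟩ = b p := by
        simp only [Fin.ext_iff, kap]; split_ifs <;> omega
      have k2 : kap m hm ⟨m, h2⟩ = b p := by
        simp only [Fin.ext_iff, kap]; split_ifs <;> omega
      rw [if_pos k1, if_pos k2]
      unfold ff
      rw [if_pos (by simp; omega), if_neg (by simp)]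
      set z := zz m d b p
      intro h0
      apply hgen (-4) (-4 * z) (by simp)
      have e : Q ^ (-4 : ℤ) * q ^ (-4 * (z : ℤ)) = ((Q⁻¹ * q⁻¹ ^ z) ^ 2) ^ 2 := by
        have : q ^ (-4 * (z : ℤ)) = (q⁻¹ ^ z) ^ 4 := by
          rw [← pow_mul, mul_comm z 4, inv_pow, neg_mul, zpow_neg]
          norm_cast
        rw [this, zpow_neg]
        norm_cast
        ring
      rw [e]
      have : (Q⁻¹ * q⁻¹ ^ z) ^ 2 = -1 := by linear_combination h0
      rw [this]; norm_num
    · simp [Fin.ext_iff]; omega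
    · rintro j - ⟨hj1, hj2⟩
      rw [if_neg]
      simp only [ne_eq, Fin.ext_iff, kap] at *
      split_ifs <;> omega
  · have h1 : (if (b p : ℕ) < m then (b p : ℕ) else b p + 1) < 2 * m := by split_ifs <;> omega
    rw [Finset.sum_eq_single_of_mem (⟨_, h1⟩ : Fin (2 * m)) (Finset.mem_univ _)]
    · have k1 : kap m hm ⟨_, h1⟩ = b p := by
        simp only [Fin.ext_iff, kap]; split_ifs <;> omega
      rw [if_pos k1, ff, if_neg]
      · simp
      · dsimp only; split_ifs <;> omega
    · rintro j - hj
      rw [if_neg]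
      simp only [ne_eq, Fin.ext_iff, kap] at *
      split_ifs at * <;> omega

/-- Over `ℂ` with generic `Q, q`, for every `m ≥ 1` the
`ℋ^B_{Q,q}(d)`-module `V_{2m-1}^{⊗d}` is a direct summand of a finite direct sum
of copies of `V_{2m}^{⊗d}`. -/
theorem odd_summand_of_even
    (Q q : ℂ) (hQ : Q ≠ 0) (hq : q ≠ 0)
    (hgen : ∀ a b : ℤ, (a, b) ≠ (0, 0) → Q ^ a * q ^ b ≠ 1)
    (d : ℕ) (hd : 1 ≤ d) (m : ℕ) (hm : 1 ≤ m) :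
    ∃ N : ℕ, 0 < N ∧
      ∃ (ι : ((Fin d → Fin (2 * m - 1)) → ℂ) →ₗ[ℂ] (Fin N → (Fin d → Fin (2 * m)) → ℂ))
        (π : (Fin N → (Fin d → Fin (2 * m)) → ℂ) →ₗ[ℂ] ((Fin d → Fin (2 * m - 1)) → ℂ)),
        (∀ i < d, ∀ x, ι (TB Q q (2 * m - 1) d i x) = fun t => TB Q q (2 * m) d i (ι x t)) ∧
        (∀ i < d, ∀ y, π (fun t => TB Q q (2 * m) d i (y t)) = TB Q q (2 * m - 1) d i (π y)) ∧
        π.comp ι = LinearMap.id := by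
  have hAT : ∀ i < d, AA Q q m d hm * TBm Q q (2 * m - 1) d i =
      TBm Q q (2 * m) d i * AA Q q m d hm := by
    intro i hi
    apply Matrix.toLin'.injective
    rw [Matrix.toLin'_mul, Matrix.toLin'_mul, ← TB_eq, ← TB_eq]
    exact LinearMap.ext fun x => AA_inter Q q hQ hq m d hm i hi x
  have hTA : ∀ i < d, (AA Q q m d hm).transpose * TBm Q q (2 * m) d i =
      TBm Q q (2 * m - 1) d i * (AA Q q m d hm).transpose := by
    intro i hi
    have := congrArg Matrix.transpose (hAT i hi)
    rw [Matrix.transpose_mul, Matrix.transpose_mul, TBm_symm, TBm_symm] at this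
    exact this.symm
  set A := AA Q q m d hm with hA
  set E := Matrix.diagonal (ee Q q m d hm) with hE
  set F := Matrix.diagonal (fun b => (ee Q q m d hm b)⁻¹) with hF
  have hne := ee_ne Q q hgen m d hm
  have hFE : F * E = 1 := by
    rw [hF, hE, Matrix.diagonal_mul_diagonal, ← Matrix.diagonal_one]
    congr 1; funext b; exact inv_mul_cancel₀ (hne b)
  have hEF : E * F = 1 := by
    rw [hF, hE, Matrix.diagonal_mul_diagonal, ← Matrix.diagonal_one]
    congr 1; funext b; exact mul_inv_cancel₀ (hne b)
  have hAA : A.transpose * A = E := AA_diag Q q m d hm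
  have hET : ∀ i < d, E * TBm Q q (2 * m - 1) d i = TBm Q q (2 * m - 1) d i * E := by
    intro i hi
    rw [← hAA, Matrix.mul_assoc, hAT i hi, ← Matrix.mul_assoc, hTA i hi, Matrix.mul_assoc]
  have hFT : ∀ i < d, F * TBm Q q (2 * m - 1) d i = TBm Q q (2 * m - 1) d i * F := by
    intro i hi
    calc F * TBm Q q (2 * m - 1) d i = F * (TBm Q q (2 * m - 1) d i * E) * F := by
          rw [Matrix.mul_assoc, Matrix.mul_assoc, hEF, Matrix.mul_one]
      _ = TBm Q q (2 * m - 1) d i * F := by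
          rw [← hET i hi, ← Matrix.mul_assoc, hFE, Matrix.one_mul]
  refine ⟨1, one_pos, LinearMap.pi fun _ => Matrix.toLin' A,
    (Matrix.toLin' (F * A.transpose)).comp (LinearMap.proj 0), ?_, ?_, ?_⟩
  · intro i hi x
    funext t
    exact AA_inter Q q hQ hq m d hm i hi x
  · intro i hi y
    simp only [LinearMap.comp_apply, LinearMap.proj_apply, TB_eq]
    rw [← Matrix.toLin'_mul_apply, ← Matrix.toLin'_mul_apply, Matrix.mul_assoc, hTA i hi,
      ← Matrix.mul_assoc, hFT i hi, Matrix.mul_assoc]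
  · apply LinearMap.ext
    intro x
    simp only [LinearMap.comp_apply, LinearMap.proj_apply, LinearMap.pi_apply]
    rw [← Matrix.toLin'_mul_apply, Matrix.mul_assoc, hAA, hFE, Matrix.toLin'_one]

end QSP
end
end
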